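/- arXiv:2501.16849 — 8 statements merged into one kernel-verified Lean document; each statement's English description precedes it below -/
import Mathlib

section
/- For all integers s ≥ 1 and d ≥ 1 with (s,d) ≠ (1,3), there exist linear forms L_{i,1}, L_{i,2} ∈ ℂ[x,y,z] (1 ≤ i ≤ s), with L_{i,1}, L_{i,2} linearly independent for each i, and linearly independent linear forms M₁, M₂ ∈ ℂ[x,y,z], such that the s+1 points [L_{i,1}=L_{i,2}=0] and [M₁=M₂=0] of ℙ² are pairwise distinct and dim_ℂ ( ⋂_{i=1}^{s} (L_{i,1}², L_{i,2}²) ∩ (M₁, M₂)³ )_d = max{0, (d+2)(d+1)/2 − 4s − 6}. (This is the content of the statement that a general union of s 2-squares and one 3-fat point has good postulation for (s,d) ≠ (1,3); by semicontinuity, good postulation of a general union follows from the existence of one configuration attaining the expected dimension.) -/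
open MvPolynomial

/-- The dimension of the degree-`d` homogeneous part of a (homogeneous) ideal
`I ⊆ ℂ[x,y,z]`, as a `ℂ`-vector space. -/
noncomputable def hdim (I : Ideal (MvPolynomial (Fin 3) ℂ)) (d : ℕ) : ℕ :=
  Module.finrank ℂ
    ((Submodule.restrictScalars ℂ I ⊓ homogeneousSubmodule (Fin 3) ℂ d :
      Submodule ℂ (MvPolynomial (Fin 3) ℂ)))

/-- The value at `P` of the monomial `x ^ p.1 * y ^ p.2` after applying the operator
`(x ∂ₓ) ^ k.1 * (y ∂_y) ^ k.2`. -/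
noncomputable def jet (P : ℂˣ × ℂˣ) (k : Fin 2 × Fin 2) (p : ℕ × ℕ) : ℂ :=
  (p.1 : ℂ) ^ (k.1 : ℕ) * (p.2 : ℂ) ^ (k.2 : ℕ) * ((P.1 : ℂ) ^ p.1 * (P.2 : ℂ) ^ p.2)

/-- The jet conditions at the points of `S` separate the polynomials with exponents in `D`. -/
def Separates (S : Finset (ℂˣ × ℂˣ)) (D : Finset (ℕ × ℕ)) : Prop :=
  ∀ c : ℕ × ℕ → ℂ, (∀ P ∈ S, ∀ k, ∑ p ∈ D, c p * jet P k p = 0) → ∀ p ∈ D, c p = 0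

/-- At most `s` points suffice to separate the polynomials with exponents in `D`. -/
def Separable (s : ℕ) (D : Finset (ℕ × ℕ)) : Prop :=
  ∃ S : Finset (ℂˣ × ℂˣ), S.card ≤ s ∧ Separates S D

lemma Separates.mono_right {S : Finset (ℂˣ × ℂˣ)} {D E : Finset (ℕ × ℕ)} (h : Separates S D)
    (hE : E ⊆ D) : Separates S E := by
  intro c hc p hp
  have := h (fun p => if p ∈ E then c p else 0) (fun P hP k => ?_) p (hE hp)
  · simpa [hp] using this
  · refine Eq.trans ?_ (hc P hP k)
    exact (Finset.sum_subset hE fun q _ hq => by rw [if_neg hq, zero_mul]).symm.trans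
      (Finset.sum_congr rfl fun q hq => by rw [if_pos hq])

lemma Separates.mono_left {S T : Finset (ℂˣ × ℂˣ)} {D : Finset (ℕ × ℕ)} (h : Separates S D)
    (hT : S ⊆ T) : Separates T D :=
  fun c hc => h c fun P hP => hc P (hT hP)

lemma Separable.mono {s : ℕ} {D E : Finset (ℕ × ℕ)} (h : Separable s D) (hE : E ⊆ D) :
    Separable s E := by
  obtain ⟨S, hS, h⟩ := h
  exact ⟨S, hS, h.mono_right hE⟩

/-- The jet conditions at the points of `S`, as a linear map. -/
noncomputable def jetMap (S : Finset (ℂˣ × ℂˣ)) (D : Finset (ℕ × ℕ)) :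
    (D → ℂ) →ₗ[ℂ] (S × (Fin 2 × Fin 2) → ℂ) where
  toFun c x := ∑ p : D, c p * jet x.1 x.2 p
  map_add' c c' := by
    ext x
    simp [add_mul, Finset.sum_add_distrib]
  map_smul' r c := by
    ext x
    simp [Finset.mul_sum, mul_assoc]

lemma jetMap_apply (S : Finset (ℂˣ × ℂˣ)) (D : Finset (ℕ × ℕ)) (c : D → ℂ)
    (x : S × (Fin 2 × Fin 2)) : jetMap S D c x = ∑ p : D, c p * jet x.1 x.2 p := rfl

lemma Separates.ker_jetMap {S : Finset (ℂˣ × ℂˣ)} {D : Finset (ℕ × ℕ)} (h : Separates S D) :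
    LinearMap.ker (jetMap S D) = ⊥ := by
  rw [LinearMap.ker_eq_bot']
  intro c hc
  ext p
  have := h (fun p => if hp : p ∈ D then c ⟨p, hp⟩ else 0) (fun P hP k => ?_) p p.2
  · simpa using this
  · rw [← Finset.sum_coe_sort]
    simpa [jetMap_apply] using congrFun hc (⟨P, hP⟩, k)

lemma Separates.exists_leftInverse {S : Finset (ℂˣ × ℂˣ)} {D : Finset (ℕ × ℕ)}
    (h : Separates S D) : ∃ A : ℕ × ℕ → S × (Fin 2 × Fin 2) → ℂ,
      ∀ c : ℕ × ℕ → ℂ, ∀ p ∈ D, c p = ∑ x, A p x * ∑ q ∈ D, c q * jet x.1 x.2 q := by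
  obtain ⟨g, hg⟩ := (jetMap S D).exists_leftInverse_of_injective h.ker_jetMap
  refine ⟨fun p x => if hp : p ∈ D then g (Pi.single x 1) ⟨p, hp⟩ else 0, fun c p hp => ?_⟩
  have h1 := congrFun (LinearMap.congr_fun hg fun q : D => c q) ⟨p, hp⟩
  rw [LinearMap.comp_apply, LinearMap.pi_apply_eq_sum_univ g] at h1
  simp only [LinearMap.id_apply, Finset.sum_apply, Pi.smul_apply, smul_eq_mul, jetMap_apply] at h1
  rw [← h1]
  refine Finset.sum_congr rfl fun x _ => ?_
  rw [← Finset.sum_coe_sort D]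
  simp only [hp, dif_pos]
  rw [mul_comm, show (fun j => if x = j then (1 : ℂ) else 0) = Pi.single x 1 by
    ext y
    simp [Pi.single_apply, eq_comm]]

/-- The point `P` moved along the one-parameter subgroup of weight `w`. -/
noncomputable def scale (w : ℤ × ℤ) (t : ℂˣ) (P : ℂˣ × ℂˣ) : ℂˣ × ℂˣ :=
  (t ^ w.1 * P.1, t ^ w.2 * P.2)

/-- The weight of an exponent. -/
def weight (w : ℤ × ℤ) (p : ℕ × ℕ) : ℤ := w.1 * p.1 + w.2 * p.2

lemma jet_scale (w : ℤ × ℤ) (t : ℂˣ) (P : ℂˣ × ℂˣ) (k : Fin 2 × Fin 2) (p : ℕ × ℕ) :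
    jet (scale w t P) k p = (t : ℂ) ^ weight w p * jet P k p := by
  simp only [jet, scale, weight, Units.val_mul, Units.val_zpow_eq_zpow_val, mul_pow,
    zpow_add₀ t.ne_zero, zpow_mul, zpow_natCast]
  ring

/-- If `e = M e` with the rows of `M` of norm less than one, then `e = 0`. -/
lemma eq_zero_of_contracting {ι : Type*} (G : Finset ι) (e : ι → ℂ) (M : ι → ι → ℂ)
    (he : ∀ g ∈ G, e g = ∑ h ∈ G, M g h * e h) (hM : ∀ g ∈ G, ∑ h ∈ G, ‖M g h‖ < 1) :
    ∀ g ∈ G, e g = 0 := by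
  intro g hg
  obtain ⟨m, hm, hmax⟩ := G.exists_max_image (fun g => ‖e g‖) ⟨g, hg⟩
  have h1 : ‖e m‖ ≤ (∑ h ∈ G, ‖M m h‖) * ‖e m‖ := by
    conv_lhs => rw [he m hm]
    rw [Finset.sum_mul]
    refine (norm_sum_le _ _).trans (Finset.sum_le_sum fun h hh => ?_)
    rw [norm_mul]
    exact mul_le_mul_of_nonneg_left (hmax h hh) (norm_nonneg _)
  have h2 : ‖e m‖ = 0 := by
    nlinarith [norm_nonneg (e m), hM m hm]
  exact norm_le_zero_iff.1 ((hmax g hg).trans h2.le)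

/-- Degeneration along a one-parameter subgroup: the part of a set of exponents of large weight
can be separated independently of the rest. -/
lemma Separable.union {s k : ℕ} {D G : Finset (ℕ × ℕ)} (hD : Separable s D) (hG : Separable k G)
    (w : ℤ × ℤ) (hw : ∀ p ∈ D, ∀ g ∈ G, weight w p < weight w g) : Separable (s + k) (D ∪ G) := by
  classical
  obtain ⟨S, hS, hD⟩ := hD
  obtain ⟨T, hT, hG⟩ := hG
  have hdisj : Disjoint D G := Finset.disjoint_left.2 fun p hp hp' => (hw p hp p hp').false
  obtain ⟨A, hA⟩ := hD.exists_leftInverse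
  obtain ⟨B, hB⟩ := hG.exists_leftInverse
  set A' : ℕ × ℕ → ℕ × ℕ → ℂ := fun p h => -∑ x, A p x * jet x.1 x.2 h with hA'
  set B' : ℕ × ℕ → ℕ × ℕ → ℂ := fun g p => -∑ x, B g x * jet x.1 x.2 p with hB'
  set N : ℝ := ∑ g ∈ G, ∑ h ∈ G, ∑ p ∈ D, ‖B' g p‖ * ‖A' p h‖ with hN
  have hN0 : 0 ≤ N := by positivity
  set t : ℂˣ := Units.mk0 ((N + 1 : ℝ) : ℂ) (by
    rw [Complex.ofReal_ne_zero]; positivity) with ht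
  have htn : ‖(t : ℂ)‖ = N + 1 := by
    rw [ht, Units.val_mk0, Complex.norm_real, Real.norm_of_nonneg (by positivity)]
  refine ⟨S ∪ T.image (scale w t), (Finset.card_union_le _ _).trans
    (add_le_add hS (Finset.card_image_le.trans hT)), fun c hc => ?_⟩
  simp only [Finset.sum_union hdisj] at hc
  have h1 : ∀ p ∈ D, c p = ∑ h ∈ G, A' p h * c h := by
    intro p hp
    have h2 : ∀ x : S × (Fin 2 × Fin 2), ∑ q ∈ D, c q * jet x.1 x.2 q
        = -∑ q ∈ G, c q * jet x.1 x.2 q := fun x =>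
      eq_neg_of_add_eq_zero_left (hc x.1 (Finset.mem_union_left _ x.1.2) x.2)
    rw [hA c p hp]
    simp only [h2, hA', neg_mul, Finset.sum_mul, mul_neg, Finset.mul_sum, Finset.sum_neg_distrib]
    rw [Finset.sum_comm]
    congr 1
    exact Finset.sum_congr rfl fun _ _ => Finset.sum_congr rfl fun _ _ => by ring
  have h3 : ∀ g ∈ G, c g * (t : ℂ) ^ weight w g
      = ∑ p ∈ D, B' g p * (c p * (t : ℂ) ^ weight w p) := by
    intro g hg
    have h2 : ∀ x : T × (Fin 2 × Fin 2), ∑ q ∈ G, c q * (t : ℂ) ^ weight w q * jet x.1 x.2 q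
        = -∑ q ∈ D, c q * (t : ℂ) ^ weight w q * jet x.1 x.2 q := by
      intro x
      have := hc (scale w t x.1)
        (Finset.mem_union_right _ (Finset.mem_image_of_mem _ x.1.2)) x.2
      simp only [jet_scale, ← mul_assoc] at this
      exact eq_neg_of_add_eq_zero_right this
    rw [hB (fun g => c g * (t : ℂ) ^ weight w g) g hg]
    simp only [h2, hB', neg_mul, Finset.sum_mul, mul_neg, Finset.mul_sum, Finset.sum_neg_distrib]
    rw [Finset.sum_comm]
    congr 1
    exact Finset.sum_congr rfl fun _ _ => Finset.sum_congr rfl fun _ _ => by ring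
  have h4 : ∀ g ∈ G, c g * (t : ℂ) ^ weight w g = 0 := by
    refine eq_zero_of_contracting G _
      (fun g h => ∑ p ∈ D, B' g p * A' p h * (t : ℂ) ^ (weight w p - weight w h)) ?_ ?_
    · intro g hg
      rw [h3 g hg]
      simp only [Finset.sum_mul]
      rw [Finset.sum_comm]
      refine Finset.sum_congr rfl fun p hp => ?_
      rw [h1 p hp, Finset.sum_mul, Finset.mul_sum]
      refine Finset.sum_congr rfl fun h _ => ?_
      rw [zpow_sub₀ t.ne_zero]
      field_simp [zpow_ne_zero (weight w h) t.ne_zero]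
    · intro g hg
      have h5 : ∑ h ∈ G, ‖∑ p ∈ D, B' g p * A' p h * (t : ℂ) ^ (weight w p - weight w h)‖
          ≤ ∑ h ∈ G, ∑ p ∈ D, ‖B' g p‖ * ‖A' p h‖ * (N + 1)⁻¹ := by
        refine Finset.sum_le_sum fun h hh => (norm_sum_le _ _).trans
          (Finset.sum_le_sum fun p hp => ?_)
        rw [norm_mul, norm_mul, norm_zpow, htn]
        gcongr
        rw [← zpow_neg_one]
        exact zpow_le_zpow_right₀ (by linarith) (by have := hw p hp h hh; omega)
      refine h5.trans_lt ?_
      simp only [← Finset.sum_mul]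
      rw [← div_eq_mul_inv, div_lt_one (by positivity)]
      have : ∑ h ∈ G, ∑ p ∈ D, ‖B' g p‖ * ‖A' p h‖ ≤ N :=
        Finset.single_le_sum (f := fun g => ∑ h ∈ G, ∑ p ∈ D, ‖B' g p‖ * ‖A' p h‖)
          (fun _ _ => by positivity) hg
      linarith
  have h6 : ∀ g ∈ G, c g = 0 := fun g hg =>
    (mul_eq_zero.1 (h4 g hg)).resolve_right (zpow_ne_zero _ t.ne_zero)
  intro p hp
  rcases Finset.mem_union.1 hp with hp | hp
  · rw [h1 p hp]
    exact Finset.sum_eq_zero fun h hh => by rw [h6 h hh, mul_zero]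
  · exact h6 p hp

/-- The set of exponents `D` translated by `v`. -/
def shift (v : ℕ × ℕ) (D : Finset (ℕ × ℕ)) : Finset (ℕ × ℕ) := D.map (addRightEmbedding v)

lemma Separable.shift {s : ℕ} {D : Finset (ℕ × ℕ)} (h : Separable s D) (v : ℕ × ℕ) :
    Separable s (shift v D) := by
  obtain ⟨S, hS, h⟩ := h
  refine ⟨S, hS, fun c hc => ?_⟩
  have key : ∀ p ∈ D, c (p + v) = 0 := by
    refine h (fun p => c (p + v)) fun P hP => ?_
    have h0 : (P.1 : ℂ) ^ v.1 * (P.2 : ℂ) ^ v.2 ≠ 0 := by simp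
    have hc' : ∀ k, ∑ p ∈ D, c (p + v) * jet P k (p + v) = 0 := by
      intro k
      simpa [_root_.shift] using hc P hP k
    have e00 : ∑ p ∈ D, c (p + v) * jet P (0, 0) (p + v) = (P.1 : ℂ) ^ v.1 * (P.2 : ℂ) ^ v.2 *
        ∑ p ∈ D, c (p + v) * jet P (0, 0) p := by
      simp only [Finset.mul_sum]
      refine Finset.sum_congr rfl fun p _ => ?_
      simp [jet, pow_add]
      ring
    have e10 : ∑ p ∈ D, c (p + v) * jet P (1, 0) (p + v) = (P.1 : ℂ) ^ v.1 * (P.2 : ℂ) ^ v.2 *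
        (∑ p ∈ D, c (p + v) * jet P (1, 0) p + v.1 * ∑ p ∈ D, c (p + v) * jet P (0, 0) p) := by
      simp only [Finset.mul_sum, ← Finset.sum_add_distrib]
      refine Finset.sum_congr rfl fun p _ => ?_
      simp [jet, pow_add]
      ring
    have e01 : ∑ p ∈ D, c (p + v) * jet P (0, 1) (p + v) = (P.1 : ℂ) ^ v.1 * (P.2 : ℂ) ^ v.2 *
        (∑ p ∈ D, c (p + v) * jet P (0, 1) p + v.2 * ∑ p ∈ D, c (p + v) * jet P (0, 0) p) := by
      simp only [Finset.mul_sum, ← Finset.sum_add_distrib]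
      refine Finset.sum_congr rfl fun p _ => ?_
      simp [jet, pow_add]
      ring
    have e11 : ∑ p ∈ D, c (p + v) * jet P (1, 1) (p + v) = (P.1 : ℂ) ^ v.1 * (P.2 : ℂ) ^ v.2 *
        (∑ p ∈ D, c (p + v) * jet P (1, 1) p + v.2 * ∑ p ∈ D, c (p + v) * jet P (1, 0) p +
          v.1 * ∑ p ∈ D, c (p + v) * jet P (0, 1) p +
          v.1 * v.2 * ∑ p ∈ D, c (p + v) * jet P (0, 0) p) := by
      simp only [Finset.mul_sum, ← Finset.sum_add_distrib]
      refine Finset.sum_congr rfl fun p _ => ?_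
      simp [jet, pow_add]
      ring
    have z00 := (mul_eq_zero.1 (e00.symm.trans (hc' _))).resolve_left h0
    have z10 := (mul_eq_zero.1 (e10.symm.trans (hc' _))).resolve_left h0
    have z01 := (mul_eq_zero.1 (e01.symm.trans (hc' _))).resolve_left h0
    have z11 := (mul_eq_zero.1 (e11.symm.trans (hc' _))).resolve_left h0
    rw [z00, mul_zero, add_zero] at z10 z01
    rw [z00, z10, z01, mul_zero, mul_zero, mul_zero, add_zero, add_zero, add_zero] at z11
    simp only [Prod.forall, Fin.forall_fin_two]
    exact ⟨⟨z00, z01⟩, z10, z11⟩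
  intro p hp
  obtain ⟨q, hq, rfl⟩ := Finset.mem_map.1 hp
  exact key q hq

/-- The determinant of the rows `(1, i, j, i * j)` for four exponents `(i, j)`. -/
def cellDet (a b c d : ℕ × ℕ) : ℤ :=
  let f (p : ℕ × ℕ) : ℤ × ℤ × ℤ :=
    (p.1 - a.1, p.2 - a.2, p.1 * p.2 - a.1 * a.2)
  (f b).1 * ((f c).2.1 * (f d).2.2 - (f c).2.2 * (f d).2.1)
    - (f b).2.1 * ((f c).1 * (f d).2.2 - (f c).2.2 * (f d).1)
    + (f b).2.2 * ((f c).1 * (f d).2.1 - (f c).2.1 * (f d).1)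

lemma eq_zero_of_cellDet_ne_zero {a b c d : ℕ × ℕ} (h : cellDet a b c d ≠ 0) {u v w z : ℂ}
    (h1 : u + v + w + z = 0) (h2 : a.1 * u + b.1 * v + c.1 * w + d.1 * z = 0)
    (h3 : a.2 * u + b.2 * v + c.2 * w + d.2 * z = 0)
    (h4 : a.1 * a.2 * u + b.1 * b.2 * v + c.1 * c.2 * w + d.1 * d.2 * z = 0) :
    u = 0 ∧ v = 0 ∧ w = 0 ∧ z = 0 := by
  have h' : ((cellDet a b c d : ℤ) : ℂ) ≠ 0 := by exact_mod_cast h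
  obtain ⟨a1, a2⟩ := a
  obtain ⟨b1, b2⟩ := b
  obtain ⟨c1, c2⟩ := c
  obtain ⟨d1, d2⟩ := d
  simp only [cellDet, Int.cast_add, Int.cast_sub, Int.cast_mul, Int.cast_natCast] at h' h2 h3 h4
  have g2 : ((b1 : ℂ) - a1) * v + (c1 - a1) * w + (d1 - a1) * z = 0 := by
    linear_combination h2 - a1 * h1
  have g3 : ((b2 : ℂ) - a2) * v + (c2 - a2) * w + (d2 - a2) * z = 0 := by
    linear_combination h3 - a2 * h1
  have g4 : ((b1 : ℂ) * b2 - a1 * a2) * v + (c1 * c2 - a1 * a2) * w + (d1 * d2 - a1 * a2) * z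
      = 0 := by
    linear_combination h4 - a1 * a2 * h1
  generalize (b1 : ℂ) - a1 = x1 at *
  generalize (c1 : ℂ) - a1 = x2 at *
  generalize (d1 : ℂ) - a1 = x3 at *
  generalize (b2 : ℂ) - a2 = y1 at *
  generalize (c2 : ℂ) - a2 = y2 at *
  generalize (d2 : ℂ) - a2 = y3 at *
  generalize (b1 : ℂ) * b2 - a1 * a2 = z1 at *
  generalize (c1 : ℂ) * c2 - a1 * a2 = z2 at *
  generalize (d1 : ℂ) * d2 - a1 * a2 = z3 at *
  have hv : v = 0 := (mul_eq_zero.1 (show _ * v = 0 by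
    linear_combination (y2 * z3 - z2 * y3) * g2 - (x2 * z3 - z2 * x3) * g3
      + (x2 * y3 - y2 * x3) * g4)).resolve_left h'
  have hw : w = 0 := (mul_eq_zero.1 (show _ * w = 0 by
    linear_combination -(y1 * z3 - z1 * y3) * g2 + (x1 * z3 - z1 * x3) * g3
      - (x1 * y3 - y1 * x3) * g4)).resolve_left h'
  have hz : z = 0 := (mul_eq_zero.1 (show _ * z = 0 by
    linear_combination (y1 * z2 - z1 * y2) * g2 - (x1 * z2 - z1 * x2) * g3
      + (x1 * y2 - y1 * x2) * g4)).resolve_left h'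
  refine ⟨?_, hv, hw, hz⟩
  simpa [hv, hw, hz] using h1

lemma separable_cell {a b c d : ℕ × ℕ} (h : cellDet a b c d ≠ 0) :
    Separable 1 {a, b, c, d} := by
  have hab : a ≠ b := by rintro rfl; simp [cellDet] at h
  have hac : a ≠ c := by rintro rfl; simp [cellDet] at h
  have had : a ≠ d := by rintro rfl; simp [cellDet] at h
  have hbc : b ≠ c := by rintro rfl; apply h; simp only [cellDet]; ring
  have hbd : b ≠ d := by rintro rfl; apply h; simp only [cellDet]; ring
  have hcd : c ≠ d := by rintro rfl; apply h; simp only [cellDet]; ring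
  refine ⟨{1}, by simp, fun e he => ?_⟩
  have he' := he 1 (Finset.mem_singleton_self _)
  have hsum : ∀ f : ℕ × ℕ → ℂ, ∑ p ∈ ({a, b, c, d} : Finset (ℕ × ℕ)), f p
      = f a + f b + f c + f d := by
    intro f
    rw [Finset.sum_insert (by simp [hab, hac, had]), Finset.sum_insert (by simp [hbc, hbd]),
      Finset.sum_insert (by simp [hcd]), Finset.sum_singleton]
    ring
  have h1 := he' (0, 0)
  have h2 := he' (1, 0)
  have h3 := he' (0, 1)
  have h4 := he' (1, 1)
  rw [hsum] at h1 h2 h3 h4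
  simp [jet] at h1 h2 h3 h4
  obtain ⟨ha, hb, hc, hd⟩ := eq_zero_of_cellDet_ne_zero h h1
    (by linear_combination h2) (by linear_combination h3) (by linear_combination h4)
  simp [ha, hb, hc, hd]

/-- `D` is exhausted by four-point conditions: some `4 * q` of its exponents are separated by `q`
points, and the at most three remaining ones cost at most one more point. -/
def Exhausted (D : Finset (ℕ × ℕ)) : Prop :=
  ∃ q : ℕ, ∃ E ⊆ D, E.card = 4 * q ∧ Separable q E ∧ D.card < 4 * q + 4 ∧
    (D = E ∨ Separable (q + 1) D)

lemma Exhausted.union {D G : Finset (ℕ × ℕ)} {k : ℕ} (hD : Exhausted D) (hG : Separable k G)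
    (hk : G.card = 4 * k) (w : ℤ × ℤ) (hw : ∀ p ∈ D, ∀ g ∈ G, weight w p < weight w g) :
    Exhausted (D ∪ G) := by
  obtain ⟨q, E, hE, hEc, hEs, hDc, h⟩ := hD
  have hdisj : Disjoint D G := Finset.disjoint_left.2 fun p hp hp' => (hw p hp p hp').false
  refine ⟨q + k, E ∪ G, Finset.union_subset_union_left hE, ?_,
    hEs.union hG w fun p hp => hw p (hE hp), ?_, ?_⟩
  · rw [Finset.card_union_of_disjoint (hdisj.mono_left hE)]
    omega
  · rw [Finset.card_union_of_disjoint hdisj]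
    omega
  · rcases h with rfl | h
    · exact Or.inl rfl
    · right
      rw [show q + k + 1 = q + 1 + k by ring]
      exact h.union hG w hw

/-- A weight together with the four exponents that it cuts off. -/
abbrev Cut := (ℤ × ℤ) × (ℕ × ℕ) × (ℕ × ℕ) × (ℕ × ℕ) × (ℕ × ℕ)

/-- The four exponents of a cut. -/
def Cut.cell (x : Cut) : Finset (ℕ × ℕ) := {x.2.1, x.2.2.1, x.2.2.2.1, x.2.2.2.2}

/-- The four exponents of a cut can be separated by one point. -/
def Cut.Regular (x : Cut) : Prop := cellDet x.2.1 x.2.2.1 x.2.2.2.1 x.2.2.2.2 ≠ 0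

instance Cut.decidableRegular : DecidablePred Cut.Regular := fun _ => inferInstanceAs (Decidable (_ ≠ _))

/-- The exponents in `R` together with those cut off by `l`. -/
def diagram (R : Finset (ℕ × ℕ)) : List Cut → Finset (ℕ × ℕ)
  | [] => R
  | x :: l => diagram R l ∪ x.cell

/-- Each cut in `l` is regular, and separates its cell from the later cells and from `R`. -/
def Valid (R : Finset (ℕ × ℕ)) : List Cut → Prop
  | [] => True
  | x :: l => x.Regular ∧ x.cell.card = 4 ∧
      (∀ p ∈ diagram R l, ∀ g ∈ x.cell, weight x.1 p < weight x.1 g) ∧ Valid R l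

instance decidableValid (R : Finset (ℕ × ℕ)) : DecidablePred (Valid R)
  | [] => inferInstanceAs (Decidable True)
  | x :: l =>
    have := decidableValid R l
    inferInstanceAs (Decidable (x.Regular ∧ x.cell.card = 4 ∧
      (∀ p ∈ diagram R l, ∀ g ∈ x.cell, weight x.1 p < weight x.1 g) ∧ Valid R l))

/-- The triangle `i + j < n` truncated by `j < h`. -/
def truncatedTriangle (n h : ℕ) : Finset (ℕ × ℕ) :=
  (Finset.range n ×ˢ Finset.range h).filter fun p => p.1 + p.2 < n

lemma exhausted_diagram {R : Finset (ℕ × ℕ)} (hR : R.card < 4) (hR' : Separable 1 R) :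
    ∀ {l : List Cut}, Valid R l → Exhausted (diagram R l)
  | [], _ => ⟨0, ∅, Finset.empty_subset _, rfl, ⟨∅, le_rfl, fun _ _ => by simp⟩, hR, Or.inr hR'⟩
  | x :: _, ⟨hx, hc, hw, hl⟩ =>
    (exhausted_diagram hR hR' hl).union (separable_cell hx) hc x.1 hw

lemma exhausted_of_valid {D R : Finset (ℕ × ℕ)} {l : List Cut} (x : Cut) (hx : x.Regular)
    (hR : R ⊆ x.cell) (hR' : R.card < 4) (hl : Valid R l) (h : D = diagram R l) : Exhausted D :=
  h ▸ exhausted_diagram hR' ((separable_cell hx).mono hR) hl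

lemma separable_of_valid {D : Finset (ℕ × ℕ)} {l : List Cut} (hl : Valid ∅ l)
    (h : D = diagram ∅ l) : Separable l.length D ∧ D.card = 4 * l.length := by
  subst h
  induction l with
  | nil => exact ⟨⟨∅, le_rfl, fun _ _ => by simp [diagram]⟩, rfl⟩
  | cons x l ih =>
    obtain ⟨hx, hc, hw, hl⟩ := hl
    obtain ⟨ih, ih'⟩ := ih hl
    refine ⟨ih.union (separable_cell hx) x.1 hw, ?_⟩
    rw [diagram, Finset.card_union_of_disjoint
      (Finset.disjoint_left.2 fun p hp hp' => (hw p hp p hp').false), ih', hc, List.length_cons]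
    ring

lemma separable_truncatedTriangle_eight : Separable 9 (truncatedTriangle 8 8) ∧
    (truncatedTriangle 8 8).card = 4 * 9 :=
  separable_of_valid (l :=
    [((1, 3), (0, 6), (0, 7), (1, 6), (2, 5)), ((3, 1), (5, 2), (6, 0), (6, 1), (7, 0)),
     ((3, 4), (1, 5), (2, 4), (3, 4), (4, 3)), ((4, -1), (4, 0), (4, 1), (5, 0), (5, 1)),
     ((1, -1), (2, 0), (3, 0), (3, 1), (4, 2)), ((3, 2), (1, 4), (2, 3), (3, 2), (3, 3)),
     ((4, 3), (0, 4), (0, 5), (1, 3), (2, 2)), ((1, 2), (0, 2), (0, 3), (1, 2), (2, 1)),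
     ((3, -2), (0, 0), (0, 1), (1, 0), (1, 1))])
    (by decide +kernel) (by decide +kernel)

lemma separable_truncatedTriangle_nine : Separable 11 (truncatedTriangle 9 8) ∧
    (truncatedTriangle 9 8).card = 4 * 11 :=
  separable_of_valid (l :=
    [((-2, 3), (0, 6), (0, 7), (1, 6), (1, 7)), ((-2, 3), (0, 4), (0, 5), (1, 5), (2, 6)),
     ((2, 1), (6, 2), (7, 0), (7, 1), (8, 0)), ((-3, 4), (0, 3), (1, 4), (2, 5), (3, 5)),
     ((-3, 2), (0, 1), (0, 2), (1, 3), (2, 4)), ((-2, 1), (0, 0), (1, 1), (1, 2), (2, 3)),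
     ((3, 4), (3, 4), (4, 3), (4, 4), (5, 3)), ((-2, 1), (1, 0), (2, 1), (2, 2), (3, 3)),
     ((-4, 3), (2, 0), (3, 1), (3, 2), (4, 2)), ((4, -1), (5, 0), (5, 1), (6, 0), (6, 1)),
     ((3, 1), (3, 0), (4, 0), (4, 1), (5, 2))])
    (by decide +kernel) (by decide +kernel)

lemma exhausted_truncatedTriangle_base {d : ℕ} (h : 4 ≤ d) (h' : d < 12) :
    Exhausted (truncatedTriangle (d + 1) (d - 2)) := by
  interval_cases d
  · exact exhausted_of_valid (R := {(0, 0)})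
      ((0, 0), (0, 0), (0, 1), (1, 0), (1, 1)) (l :=
    [((3, 4), (2, 1), (3, 0), (3, 1), (4, 0)), ((2, 3), (0, 1), (1, 0), (1, 1), (2, 0))])
      (by decide) (by decide) (by decide) (by decide +kernel) (by decide +kernel)
  · exact exhausted_of_valid (R := {(0, 0), (0, 1), (1, 0)})
      ((0, 0), (0, 0), (0, 1), (1, 0), (1, 1)) (l :=
    [((4, 1), (3, 2), (4, 0), (4, 1), (5, 0)), ((2, 1), (2, 1), (2, 2), (3, 0), (3, 1)),
     ((4, 3), (0, 2), (1, 1), (1, 2), (2, 0))])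
      (by decide) (by decide) (by decide) (by decide +kernel) (by decide +kernel)
  · exact exhausted_of_valid (R := {(4, 0), (5, 0)})
      ((0, 0), (4, 0), (5, 0), (0, 1), (1, 1)) (l :=
    [((2, 3), (2, 3), (3, 3), (4, 2), (5, 1)), ((-1, 3), (0, 2), (0, 3), (1, 2), (1, 3)),
     ((1, 2), (2, 2), (3, 2), (4, 1), (6, 0)), ((-2, 1), (0, 0), (0, 1), (1, 0), (1, 1)),
     ((-1, 0), (2, 0), (2, 1), (3, 0), (3, 1))])
      (by decide) (by decide) (by decide) (by decide +kernel) (by decide +kernel)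
  · exact exhausted_of_valid (R := {(0, 1), (0, 2)})
      ((0, 0), (0, 1), (0, 2), (1, 0), (1, 1)) (l :=
    [((2, 1), (5, 2), (6, 0), (6, 1), (7, 0)), ((3, -2), (4, 0), (4, 1), (5, 0), (5, 1)),
     ((3, -4), (2, 0), (3, 0), (3, 1), (4, 2)), ((1, -4), (0, 0), (1, 0), (1, 1), (2, 1)),
     ((3, -2), (2, 2), (3, 2), (3, 3), (4, 3)), ((4, -1), (1, 2), (2, 3), (2, 4), (3, 4)),
     ((2, 3), (0, 3), (0, 4), (1, 3), (1, 4))])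
      (by decide) (by decide) (by decide) (by decide +kernel) (by decide +kernel)
  · exact exhausted_of_valid (R := {(0, 2), (1, 2), (2, 3)})
      ((0, 0), (0, 2), (1, 2), (2, 3), (0, 0)) (l :=
    [((4, 1), (6, 2), (7, 0), (7, 1), (8, 0)), ((2, -1), (5, 0), (5, 1), (6, 0), (6, 1)),
     ((2, -1), (4, 0), (4, 1), (5, 2), (5, 3)), ((4, -3), (2, 0), (3, 0), (3, 1), (4, 2)),
     ((2, -3), (0, 0), (1, 0), (2, 1), (3, 2)), ((1, -2), (0, 1), (1, 1), (2, 2), (4, 3)),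
     ((1, 1), (2, 5), (3, 4), (3, 5), (4, 4)), ((2, 3), (0, 5), (1, 5), (2, 4), (3, 3)),
     ((-1, 3), (0, 3), (0, 4), (1, 3), (1, 4))])
      (by decide) (by decide) (by decide) (by decide +kernel) (by decide +kernel)
  · exact exhausted_of_valid (R := {(0, 2)})
      ((0, 0), (0, 2), (0, 0), (1, 0), (1, 1)) (l :=
    [((3, 1), (7, 2), (8, 0), (8, 1), (9, 0)), ((3, -1), (6, 0), (6, 1), (7, 0), (7, 1)),
     ((3, 1), (5, 3), (5, 4), (6, 2), (6, 3)), ((2, 3), (2, 6), (3, 5), (3, 6), (4, 5)),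
     ((1, 4), (0, 6), (1, 5), (1, 6), (2, 5)), ((3, 4), (3, 4), (4, 3), (4, 4), (5, 2)),
     ((1, 2), (0, 5), (1, 4), (2, 4), (3, 3)), ((1, 3), (0, 4), (1, 3), (2, 3), (4, 2)),
     ((3, -2), (4, 0), (4, 1), (5, 0), (5, 1)), ((3, 4), (0, 3), (2, 2), (3, 1), (3, 2)),
     ((4, 3), (1, 2), (2, 0), (2, 1), (3, 0)), ((-3, -4), (0, 0), (0, 1), (1, 0), (1, 1))])
      (by decide) (by decide) (by decide) (by decide +kernel) (by decide +kernel)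
  · exact exhausted_of_valid (R := ∅)
      ((0, 0), (0, 0), (0, 1), (1, 0), (1, 1)) (l :=
    [((3, 1), (8, 2), (9, 0), (9, 1), (10, 0)), ((4, -3), (7, 0), (7, 1), (8, 0), (8, 1)),
     ((4, -1), (6, 0), (6, 1), (7, 2), (7, 3)), ((2, -1), (5, 0), (5, 1), (6, 2), (6, 3)),
     ((3, -2), (4, 0), (4, 1), (5, 2), (6, 4)), ((3, 4), (2, 7), (3, 7), (4, 6), (5, 5)),
     ((3, 4), (1, 7), (3, 6), (4, 5), (5, 4)), ((1, 2), (0, 7), (1, 6), (2, 6), (3, 5)),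
     ((3, 4), (2, 5), (3, 4), (4, 4), (5, 3)), ((3, 1), (3, 2), (3, 3), (4, 2), (4, 3)),
     ((1, 4), (0, 5), (0, 6), (1, 5), (2, 4)), ((4, -3), (2, 0), (2, 1), (3, 0), (3, 1)),
     ((3, -4), (0, 0), (1, 0), (1, 1), (2, 2)), ((-2, 3), (0, 3), (0, 4), (1, 3), (1, 4)),
     ((2, -1), (0, 1), (0, 2), (1, 2), (2, 3))])
      (by decide) (by decide) (by decide) (by decide +kernel) (by decide +kernel)
  · exact exhausted_of_valid (R := ∅)
      ((0, 0), (0, 0), (0, 1), (1, 0), (1, 1)) (l :=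
    [((2, 3), (2, 8), (3, 8), (4, 7), (5, 6)), ((-3, 4), (0, 7), (0, 8), (1, 7), (1, 8)),
     ((1, 2), (2, 7), (3, 7), (4, 6), (6, 5)), ((3, 1), (9, 2), (10, 0), (10, 1), (11, 0)),
     ((2, -1), (8, 0), (8, 1), (9, 0), (9, 1)), ((3, 1), (7, 3), (7, 4), (8, 2), (8, 3)),
     ((3, 2), (5, 5), (6, 3), (6, 4), (7, 2)), ((3, -1), (6, 0), (6, 1), (7, 0), (7, 1)),
     ((4, 3), (3, 6), (4, 5), (5, 4), (6, 2)), ((3, 2), (3, 5), (4, 4), (5, 2), (5, 3)),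
     ((3, 1), (4, 2), (4, 3), (5, 0), (5, 1)), ((4, -3), (3, 0), (3, 1), (4, 0), (4, 1)),
     ((1, 1), (1, 6), (2, 5), (2, 6), (3, 4)), ((2, -1), (2, 0), (2, 1), (3, 2), (3, 3)),
     ((2, 3), (0, 5), (0, 6), (1, 5), (2, 4)), ((-1, 2), (0, 3), (0, 4), (1, 3), (1, 4)),
     ((3, -4), (0, 0), (1, 0), (1, 1), (2, 2)), ((-2, 3), (0, 1), (0, 2), (1, 2), (2, 3))])
      (by decide) (by decide) (by decide) (by decide +kernel) (by decide +kernel)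

lemma separable_rectangle : Separable 4 (Finset.range 2 ×ˢ Finset.range 8) ∧
    (Finset.range 2 ×ˢ Finset.range 8).card = 4 * 4 :=
  separable_of_valid (l :=
    [((0, 1), (0, 6), (0, 7), (1, 6), (1, 7)), ((0, 1), (0, 4), (0, 5), (1, 4), (1, 5)),
     ((0, 1), (0, 2), (0, 3), (1, 2), (1, 3)), ((0, 1), (0, 0), (0, 1), (1, 0), (1, 1))])
    (by decide +kernel) (by decide +kernel)

lemma mem_truncatedTriangle {n h : ℕ} {p : ℕ × ℕ} :
    p ∈ truncatedTriangle n h ↔ p.1 + p.2 < n ∧ p.2 < h := by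
  simp only [truncatedTriangle, Finset.mem_filter, Finset.mem_product, Finset.mem_range]
  omega

lemma mem_shift {v p : ℕ × ℕ} {D : Finset (ℕ × ℕ)} :
    p ∈ shift v D ↔ ∃ q ∈ D, q.1 + v.1 = p.1 ∧ q.2 + v.2 = p.2 := by
  simp [shift, Prod.ext_iff]

lemma card_shift (v : ℕ × ℕ) (D : Finset (ℕ × ℕ)) : (shift v D).card = D.card :=
  Finset.card_map _

lemma separable_strip : ∀ n : ℕ, 8 ≤ n →
    ∃ k, Separable k (truncatedTriangle n 8) ∧ (truncatedTriangle n 8).card = 4 * k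
  | 8, _ => ⟨9, separable_truncatedTriangle_eight⟩
  | 9, _ => ⟨11, separable_truncatedTriangle_nine⟩
  | n + 10, _ => by
    obtain ⟨k, hk, hk'⟩ := separable_strip (n + 8) (by omega)
    have hw : ∀ p ∈ shift (2, 0) (truncatedTriangle (n + 8) 8),
        ∀ g ∈ Finset.range 2 ×ˢ Finset.range 8, weight (-1, 0) p < weight (-1, 0) g := by
      intro p hp g hg
      obtain ⟨q, -, hq, -⟩ := mem_shift.1 hp
      simp only [Finset.mem_product, Finset.mem_range] at hg
      simp only [weight]
      omega
    have heq : truncatedTriangle (n + 10) 8 =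
        shift (2, 0) (truncatedTriangle (n + 8) 8) ∪ Finset.range 2 ×ˢ Finset.range 8 := by
      ext ⟨i, j⟩
      simp only [Finset.mem_union, mem_shift, Finset.mem_product, Finset.mem_range,
        mem_truncatedTriangle, Prod.exists]
      constructor
      · rintro ⟨h1, h2⟩
        by_cases hi : i < 2
        · exact Or.inr ⟨hi, h2⟩
        · exact Or.inl ⟨i - 2, j, by omega, by omega, by omega⟩
      · rintro (⟨a, b, h1, h2, h3⟩ | h1) <;> omega
    refine ⟨k + 4, heq ▸ (hk.shift (2, 0)).union separable_rectangle.1 (-1, 0) hw, ?_⟩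
    rw [heq, Finset.card_union_of_disjoint
      (Finset.disjoint_left.2 fun p hp hp' => (hw p hp p hp').false), card_shift, hk',
      separable_rectangle.2]
    ring

lemma Exhausted.shift {D : Finset (ℕ × ℕ)} (h : Exhausted D) (v : ℕ × ℕ) :
    Exhausted (shift v D) := by
  obtain ⟨q, E, hE, hEc, hEs, hDc, h⟩ := h
  refine ⟨q, _root_.shift v E, Finset.map_subset_map.2 hE, by rwa [card_shift], hEs.shift v,
    by rwa [card_shift], ?_⟩
  rcases h with rfl | h
  · exact Or.inl rfl
  · exact Or.inr (h.shift v)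

lemma exhausted_truncatedTriangle (d : ℕ) (hd : 4 ≤ d) :
    Exhausted (truncatedTriangle (d + 1) (d - 2)) := by
  induction d using Nat.strong_induction_on with
  | _ d ih =>
    by_cases h : d < 12
    · exact exhausted_truncatedTriangle_base hd h
    · obtain ⟨e, rfl⟩ : ∃ e, d = e + 8 := ⟨d - 8, by omega⟩
      obtain ⟨k, hk, hk'⟩ := separable_strip (e + 8 + 1) (by omega)
      have heq : truncatedTriangle (e + 8 + 1) (e + 8 - 2) =
          shift (0, 8) (truncatedTriangle (e + 1) (e - 2)) ∪ truncatedTriangle (e + 8 + 1) 8 := by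
        ext ⟨i, j⟩
        simp only [Finset.mem_union, mem_shift, mem_truncatedTriangle, Prod.exists]
        constructor
        · rintro ⟨h1, h2⟩
          by_cases hj : j < 8
          · exact Or.inr ⟨h1, hj⟩
          · exact Or.inl ⟨i, j - 8, by omega, by omega, by omega⟩
        · rintro (⟨a, b, h1, h2, h3⟩ | h1) <;> omega
      rw [heq]
      refine ((ih e (by omega) (by omega)).shift (0, 8)).union hk hk' (0, -1) fun p hp g hg => ?_
      obtain ⟨q, -, -, hq⟩ := mem_shift.1 hp
      rw [mem_truncatedTriangle] at hg
      simp only [weight]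
      omega

lemma separable_row : Separable 2 (truncatedTriangle 4 1) := by
  have h : ∀ i, Separable 1 {(i, 0), (i + 1, 0)} := fun i =>
    (separable_cell (a := (i, 0)) (b := (i + 1, 0)) (c := (i, 1)) (d := (i + 1, 1))
      (by simp [cellDet])).mono (by simp [Finset.insert_subset_iff])
  rw [show truncatedTriangle 4 1 = {(0, 0), (0 + 1, 0)} ∪ {(2, 0), (2 + 1, 0)} by decide +kernel]
  exact (h 0).union (h 2) (1, 0) (by decide)

lemma card_truncatedTriangle_succ (n h : ℕ) :
    (truncatedTriangle (n + 1) (h + 1)).card = (truncatedTriangle n h).card + (n + 1) := by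
  have heq : truncatedTriangle (n + 1) (h + 1) =
      shift (0, 1) (truncatedTriangle n h) ∪ Finset.range (n + 1) ×ˢ {0} := by
    ext ⟨i, j⟩
    simp only [Finset.mem_union, mem_shift, mem_truncatedTriangle, Prod.exists, Finset.mem_product,
      Finset.mem_range, Finset.mem_singleton]
    constructor
    · rintro ⟨h1, h2⟩
      by_cases hj : j = 0
      · exact Or.inr ⟨by omega, hj⟩
      · exact Or.inl ⟨i, j - 1, by omega, by omega, by omega⟩
    · rintro (⟨a, b, h1, h2, h3⟩ | h1) <;> omega
  rw [heq, Finset.card_union_of_disjoint, card_shift, Finset.card_product, Finset.card_range,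
    Finset.card_singleton, mul_one]
  refine Finset.disjoint_left.2 fun p hp hp' => ?_
  obtain ⟨q, -, -, hq⟩ := mem_shift.1 hp
  simp only [Finset.mem_product, Finset.mem_range, Finset.mem_singleton] at hp'
  omega

lemma card_truncatedTriangle (k : ℕ) :
    2 * ((truncatedTriangle (k + 3) k).card + 6) = (k + 4) * (k + 3) := by
  induction k with
  | zero => decide
  | succ k ih =>
    rw [card_truncatedTriangle_succ]
    linarith

lemma exists_card_eq_separates {s k : ℕ} {D : Finset (ℕ × ℕ)} (h : Separable k D) (hk : k ≤ s) :
    ∃ S : Finset (ℂˣ × ℂˣ), S.card = s ∧ Separates S D := by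
  obtain ⟨S, hS, h⟩ := h
  have : Infinite ℂˣ := Infinite.of_injective
    (fun n : ℕ => Units.mk0 ((n : ℂ) + 1) (Nat.cast_add_one_ne_zero n)) fun m n h => by
      simpa using congrArg Units.val h
  obtain ⟨T, hT, hT'⟩ := Infinite.exists_superset_card_eq S s (hS.trans hk)
  exact ⟨T, hT', h.mono_left hT⟩

lemma Separates.finrank_ker_jetMap {S : Finset (ℂˣ × ℂˣ)} {D : Finset (ℕ × ℕ)}
    (h : Separates S D) : Module.finrank ℂ (LinearMap.ker (jetMap S D)) = 0 := by
  rw [h.ker_jetMap, finrank_bot]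

lemma Separates.jetMap_surjective {S T : Finset (ℂˣ × ℂˣ)} {D E : Finset (ℕ × ℕ)}
    (h : Separates S E) (hE : E ⊆ D) (hcard : E.card = 4 * S.card) (hT : T ⊆ S) :
    Function.Surjective (jetMap T D) := by
  have hS : Function.Surjective (jetMap S E) := by
    refine (LinearMap.injective_iff_surjective_of_finrank_eq_finrank ?_).1
      (LinearMap.ker_eq_bot.1 h.ker_jetMap)
    simp [hcard, mul_comm]
  intro y
  obtain ⟨c, hc⟩ := hS fun x => if hx : (x.1 : ℂˣ × ℂˣ) ∈ T then y (⟨x.1, hx⟩, x.2) else 0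
  refine ⟨fun p => if hp : (p : ℕ × ℕ) ∈ E then c ⟨p, hp⟩ else 0, ?_⟩
  ext ⟨P, k⟩
  have := congrFun hc (⟨P, hT P.2⟩, k)
  simp only [jetMap_apply, P.2, dif_pos] at this ⊢
  rw [← this, Finset.sum_coe_sort D
    (fun p => (if hp : p ∈ E then c ⟨p, hp⟩ else 0) * jet P k p), ← Finset.sum_subset hE]
  · rw [← Finset.sum_coe_sort]
    simp
  · intro p _ hp
    simp [hp]

lemma Exhausted.exists_finrank_ker_jetMap {D : Finset (ℕ × ℕ)} (h : Exhausted D) (s : ℕ) :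
    ∃ S : Finset (ℂˣ × ℂˣ), S.card = s ∧
      Module.finrank ℂ (LinearMap.ker (jetMap S D)) = D.card - 4 * s := by
  obtain ⟨q, E, hE, hEc, ⟨S, hS, hES⟩, hDc, h⟩ := h
  rcases le_or_gt s q with hs | hs
  · have hSq : S.card = q := by
      refine le_antisymm hS ?_
      have := LinearMap.finrank_le_finrank_of_injective (LinearMap.ker_eq_bot.1 hES.ker_jetMap)
      simp at this
      omega
    obtain ⟨T, hT, hTs⟩ := Finset.exists_subset_card_eq (hs.trans hSq.ge)
    refine ⟨T, hTs, ?_⟩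
    have h1 := (jetMap T D).finrank_range_add_finrank_ker
    rw [LinearMap.range_eq_top.2 (hES.jetMap_surjective hE (by omega) hT), finrank_top] at h1
    simp [hTs] at h1
    omega
  · have hD : Separable (q + 1) D := by
      rcases h with rfl | h
      · exact ⟨S, by omega, hES⟩
      · exact h
    obtain ⟨T, hTs, hT⟩ := exists_card_eq_separates hD hs
    exact ⟨T, hTs, by rw [hT.finrank_ker_jetMap]; omega⟩

lemma exists_finrank_ker_jetMap (s d : ℕ) (hs : 1 ≤ s) (hsd : ¬ (s = 1 ∧ d = 3)) :
    ∃ S : Finset (ℂˣ × ℂˣ), S.card = s ∧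
      Module.finrank ℂ (LinearMap.ker (jetMap S (truncatedTriangle (d + 1) (d - 2)))) =
        (truncatedTriangle (d + 1) (d - 2)).card - 4 * s := by
  rcases lt_trichotomy d 3 with hd | rfl | hd
  · obtain ⟨S, hS, h⟩ := exists_card_eq_separates (s := s) (k := 0) (D := ∅)
      ⟨∅, le_rfl, fun _ _ => by simp⟩ (by omega)
    have : truncatedTriangle (d + 1) (d - 2) = ∅ := by interval_cases d <;> rfl
    exact ⟨S, hS, by rw [this, h.finrank_ker_jetMap]; simp⟩
  · obtain ⟨S, hS, h⟩ := exists_card_eq_separates (s := s) separable_row (by omega)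
    refine ⟨S, hS, h.finrank_ker_jetMap.trans ?_⟩
    have : (truncatedTriangle 4 1).card = 4 := by decide +kernel
    norm_num [this]
    omega
  · exact (exhausted_truncatedTriangle d hd).exists_finrank_ker_jetMap s

/-- The polynomials all of whose monomials have degree at least `n` in `X 0` and `X 2`. -/
noncomputable def supportIdeal (n : ℕ) : Ideal (MvPolynomial (Fin 3) ℂ) where
  carrier := {F | ∀ m ∈ F.support, n ≤ m 0 + m 2}
  add_mem' := by
    classical
    intro F G hF hG m hm
    rcases Finset.mem_union.1 (support_add hm) with h | h
    exacts [hF m h, hG m h]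
  zero_mem' := by simp
  smul_mem' := by
    classical
    intro F G hG m hm
    obtain ⟨a, -, b, hb, rfl⟩ := Finset.mem_add.1 (support_mul F G hm)
    have := hG b hb
    simp only [Finsupp.add_apply]
    omega

lemma supportIdeal_mul_le (a b : ℕ) : supportIdeal a * supportIdeal b ≤ supportIdeal (a + b) := by
  classical
  refine Ideal.mul_le.2 fun F hF G hG m hm => ?_
  obtain ⟨p, hp, q, hq, rfl⟩ := Finset.mem_add.1 (support_mul F G hm)
  have h1 := hF p hp
  have h2 := hG q hq
  simp only [Finsupp.add_apply]
  omega

lemma span_pow_eq_supportIdeal (n : ℕ) :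
    (Ideal.span {X 0, X 2} : Ideal (MvPolynomial (Fin 3) ℂ)) ^ n = supportIdeal n := by
  apply le_antisymm
  · induction n with
    | zero => exact fun F _ m _ => Nat.zero_le _
    | succ n ih =>
      rw [pow_succ]
      refine (Ideal.mul_mono ih ?_).trans (supportIdeal_mul_le n 1)
      rw [Ideal.span_le]
      rintro F (rfl | rfl) m hm <;> simp [support_X] at hm <;> subst hm <;> simp
  · intro F hF
    rw [F.as_sum]
    refine Ideal.sum_mem _ fun m hm => ?_
    have h0 : (X 0 : MvPolynomial (Fin 3) ℂ) ∈ Ideal.span {X 0, X 2} :=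
      Ideal.subset_span (by simp)
    have h2 : (X 2 : MvPolynomial (Fin 3) ℂ) ∈ Ideal.span {X 0, X 2} :=
      Ideal.subset_span (by simp)
    have := Ideal.mul_mem_mul (Ideal.pow_mem_pow h0 (m 0)) (Ideal.pow_mem_pow h2 (m 2))
    rw [← pow_add] at this
    rw [monomial_eq, Finsupp.prod_fintype _ _ (by simp), Fin.prod_univ_three,
      mul_right_comm (X 0 ^ m 0)]
    exact Ideal.mul_mem_left _ _ (Ideal.mul_mem_right _ _ (Ideal.pow_le_pow_right (hF m hm) this))

/-- The exponent of degree `d` in three variables with dehomogenization `p`. -/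
noncomputable def homogExponent (d : ℕ) (p : ℕ × ℕ) : Fin 3 →₀ ℕ :=
  Finsupp.equivFunOnFinite.symm ![p.1, p.2, d - p.1 - p.2]

lemma homogExponent_injective (d : ℕ) : Function.Injective (homogExponent d) := by
  intro p q h
  have h0 := DFunLike.congr_fun h 0
  have h1 := DFunLike.congr_fun h 1
  simp [homogExponent] at h0 h1
  exact Prod.ext h0 h1

lemma monomial_homogExponent (d : ℕ) (p : ℕ × ℕ) (c : ℂ) :
    monomial (homogExponent d p) c = C c * (X 0 ^ p.1 * X 1 ^ p.2 * X 2 ^ (d - p.1 - p.2)) := by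
  rw [monomial_eq, Finsupp.prod_fintype _ _ (by simp), Fin.prod_univ_three]
  simp [homogExponent]

/-- The form of degree `d` with the given coefficients. -/
noncomputable def toForm (d : ℕ) (D : Finset (ℕ × ℕ)) :
    (D → ℂ) →ₗ[ℂ] MvPolynomial (Fin 3) ℂ :=
  ∑ p : D, (monomial (homogExponent d p)).comp (LinearMap.proj p)

lemma toForm_apply (d : ℕ) (D : Finset (ℕ × ℕ)) (c : D → ℂ) :
    toForm d D c = ∑ p : D, monomial (homogExponent d p) (c p) := by
  simp [toForm]

lemma coeff_toForm (d : ℕ) (D : Finset (ℕ × ℕ)) (c : D → ℂ) (p : D) :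
    coeff (homogExponent d p) (toForm d D c) = c p := by
  classical
  rw [toForm_apply, coeff_sum, Finset.sum_eq_single p]
  · simp
  · intro q _ hq
    rw [coeff_monomial, if_neg]
    exact fun h => hq (Subtype.ext (homogExponent_injective d h))
  · simp

lemma toForm_injective (d : ℕ) (D : Finset (ℕ × ℕ)) : Function.Injective (toForm d D) := by
  intro c c' h
  ext p
  rw [← coeff_toForm d D c p, h, coeff_toForm]

lemma range_toForm (d : ℕ) (D : Finset (ℕ × ℕ)) (hD : ∀ p ∈ D, p.1 + p.2 ≤ d) :
    LinearMap.range (toForm d D) =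
      (homogeneousSubmodule (Fin 3) ℂ d ⊓ restrictSupport ℂ {m | (m 0, m 1) ∈ D}) := by
  classical
  apply le_antisymm
  · rintro _ ⟨c, rfl⟩
    rw [toForm_apply]
    refine Submodule.sum_mem _ fun p _ => ⟨?_, ?_⟩
    · refine isHomogeneous_monomial _ ?_
      have := hD p p.2
      simp [homogExponent, Finsupp.degree_eq_sum, Fin.sum_univ_three]
      omega
    · intro m hm
      have := Finset.mem_singleton.1 (support_monomial_subset hm)
      subst this
      simp [homogExponent]
  · rintro F ⟨hF, hF'⟩
    refine ⟨fun p => coeff (homogExponent d p) F, ?_⟩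
    ext m
    rw [toForm_apply, coeff_sum]
    by_cases hm : m ∈ F.support
    · have hd : m 0 + m 1 + m 2 = d := by
        have := hF (mem_support_iff.1 hm)
        simpa [Finsupp.weight_apply, Finsupp.sum_fintype, Fin.sum_univ_three] using this
      have hmD : (m 0, m 1) ∈ D := hF' hm
      have hm' : homogExponent d (m 0, m 1) = m := by
        ext i
        fin_cases i <;> simp [homogExponent]
        omega
      rw [Finset.sum_eq_single ⟨_, hmD⟩]
      · simp [hm']
      · intro q _ hq
        rw [coeff_monomial, if_neg]
        exact fun h => hq (Subtype.ext (homogExponent_injective d (h.trans hm'.symm)))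
      · simp
    · rw [notMem_support_iff.1 hm]
      refine Finset.sum_eq_zero fun p _ => ?_
      rw [coeff_monomial]
      split_ifs with h
      · rw [h, notMem_support_iff.1 hm]
      · rfl

/-- The ideal of the 2-square at `P` whose lines are the two coordinate directions. -/
noncomputable def squareIdeal (P : ℂˣ × ℂˣ) : Ideal (MvPolynomial (Fin 3) ℂ) :=
  Ideal.span {(X 0 - C (P.1 : ℂ) * X 2) ^ 2, (X 1 - C (P.2 : ℂ) * X 2) ^ 2}

lemma pow_of_sub_sq_eq_zero {R : Type*} [CommRing R] {x z a a' : R} (ha : a * a' = 1)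
    (hx : (x - a * z) ^ 2 = 0) (i : ℕ) :
    x ^ i = a ^ i * (z ^ i + i * (a' * (x - a * z)) * z ^ (i - 1)) := by
  have h0 : ∀ i : ℕ, x ^ (i + 1) =
      a ^ (i + 1) * (z ^ (i + 1) + (i + 1) * (a' * (x - a * z)) * z ^ i) := by
    intro i
    induction i with
    | zero => linear_combination -(x - a * z) * ha
    | succ i ih =>
      rw [pow_succ, ih]
      push_cast
      linear_combination a ^ (i + 1) * (i + 1) * a' * z ^ i * hx
        - a ^ (i + 1) * z ^ (i + 1) * (x - a * z) * ha
  cases i with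
  | zero => simp
  | succ i => rw [h0]; simp

lemma monomial_of_sub_sq_eq_zero {R : Type*} [CommRing R] {x y z a a' b b' : R}
    (ha : a * a' = 1) (hb : b * b' = 1) (hx : (x - a * z) ^ 2 = 0) (hy : (y - b * z) ^ 2 = 0)
    {i j l d : ℕ} (hd : i + j + l = d) :
    x ^ i * y ^ j * z ^ l = a ^ i * b ^ j * z ^ d
      + i * (a ^ i * b ^ j) * (a' * (x - a * z) * z ^ (d - 1))
      + j * (a ^ i * b ^ j) * (b' * (y - b * z) * z ^ (d - 1))
      + i * j * (a ^ i * b ^ j) * (a' * (x - a * z) * (b' * (y - b * z)) * z ^ (d - 2)) := by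
  rw [pow_of_sub_sq_eq_zero ha hx, pow_of_sub_sq_eq_zero hb hy]
  subst hd
  rcases i with _ | i <;> rcases j with _ | j
  · simp
  · rw [show 0 + (j + 1) + l - 1 = j + l by omega]
    simp
    ring
  · rw [show i + 1 + 0 + l - 1 = i + l by omega]
    simp
    ring
  · rw [show i + 1 + (j + 1) + l - 1 = i + j + l + 1 by omega,
      show i + 1 + (j + 1) + l - 2 = i + j + l by omega]
    simp
    ring

lemma toForm_mem_squareIdeal {d : ℕ} {D : Finset (ℕ × ℕ)} (hD : ∀ p ∈ D, p.1 + p.2 ≤ d)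
    (P : ℂˣ × ℂˣ) (c : D → ℂ) (hc : ∀ k, ∑ p : D, c p * jet P k p = 0) :
    toForm d D c ∈ squareIdeal P := by
  rw [← Ideal.Quotient.eq_zero_iff_mem]
  set f := Ideal.Quotient.mk (squareIdeal P)
  have ha : f (C (P.1 : ℂ)) * f (C ((P.1⁻¹ : ℂˣ) : ℂ)) = 1 := by
    rw [← map_mul, ← C_mul, Units.mul_inv, C_1, map_one]
  have hb : f (C (P.2 : ℂ)) * f (C ((P.2⁻¹ : ℂˣ) : ℂ)) = 1 := by
    rw [← map_mul, ← C_mul, Units.mul_inv, C_1, map_one]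
  have hx : (f (X 0) - f (C (P.1 : ℂ)) * f (X 2)) ^ 2 = 0 := by
    rw [← map_mul, ← map_sub, ← map_pow]
    exact Ideal.Quotient.eq_zero_iff_mem.2 (Ideal.subset_span (by simp))
  have hy : (f (X 1) - f (C (P.2 : ℂ)) * f (X 2)) ^ 2 = 0 := by
    rw [← map_mul, ← map_sub, ← map_pow]
    exact Ideal.Quotient.eq_zero_iff_mem.2 (Ideal.subset_span (by simp))
  have h0 : ∀ k, ∑ p : D, f (C (c p)) * f (C (jet P k p)) = 0 := by
    intro k
    simp only [← map_mul, ← map_sum]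
    rw [hc k, map_zero, map_zero]
  rw [toForm_apply, map_sum]
  have h1 : ∀ p : D, f (monomial (homogExponent d p) (c p)) =
      f (C (c p)) * f (C (jet P (0, 0) p)) * f (X 2) ^ d
      + f (C (c p)) * f (C (jet P (1, 0) p)) * (f (C ((P.1⁻¹ : ℂˣ) : ℂ)) *
        (f (X 0) - f (C (P.1 : ℂ)) * f (X 2)) * f (X 2) ^ (d - 1))
      + f (C (c p)) * f (C (jet P (0, 1) p)) * (f (C ((P.2⁻¹ : ℂˣ) : ℂ)) *
        (f (X 1) - f (C (P.2 : ℂ)) * f (X 2)) * f (X 2) ^ (d - 1))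
      + f (C (c p)) * f (C (jet P (1, 1) p)) * (f (C ((P.1⁻¹ : ℂˣ) : ℂ)) *
        (f (X 0) - f (C (P.1 : ℂ)) * f (X 2)) * (f (C ((P.2⁻¹ : ℂˣ) : ℂ)) *
        (f (X 1) - f (C (P.2 : ℂ)) * f (X 2))) * f (X 2) ^ (d - 2)) := by
    intro p
    have := hD p p.2
    rw [monomial_homogExponent, map_mul, map_mul, map_mul, map_pow, map_pow, map_pow,
      monomial_of_sub_sq_eq_zero ha hb hx hy
        (show (p : ℕ × ℕ).1 + (p : ℕ × ℕ).2 + (d - (p : ℕ × ℕ).1 - (p : ℕ × ℕ).2) = d by omega)]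
    simp only [jet, Fin.val_zero, Fin.val_one, pow_zero, pow_one, one_mul, mul_one, map_mul,
      map_pow, map_natCast]
    ring
  simp only [h1, Finset.sum_add_distrib, ← Finset.sum_mul, h0, zero_mul, add_zero]

lemma jet_eq_zero_of_mem_squareIdeal {d : ℕ} {D : Finset (ℕ × ℕ)} (P : ℂˣ × ℂˣ) (c : D → ℂ)
    (hc : toForm d D c ∈ squareIdeal P) (k : Fin 2 × Fin 2) : ∑ p : D, c p * jet P k p = 0 := by
  set e := eval ![(P.1 : ℂ), (P.2 : ℂ), 1] with he
  have hz : ∀ (a : ℂ) (n : ℕ), a * (n * a ^ (n - 1)) = n * a ^ n := by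
    intro a n
    cases n with
    | zero => simp
    | succ n => simp; ring
  have h00 : ∑ p : D, c p * jet P (0, 0) p = e (toForm d D c) := by
    simp [toForm_apply, monomial_homogExponent, he, jet]
  have h10 : ∑ p : D, c p * jet P (1, 0) p = P.1 * e (pderiv 0 (toForm d D c)) := by
    simp only [toForm_apply, map_sum, monomial_homogExponent, Finset.mul_sum]
    refine Finset.sum_congr rfl fun p _ => ?_
    simp [he, jet, Derivation.leibniz_pow, Derivation.leibniz, pderiv_X]
    linear_combination -c p * (P.2 : ℂ) ^ p.1.2 * hz P.1 p.1.1
  have h01 : ∑ p : D, c p * jet P (0, 1) p = P.2 * e (pderiv 1 (toForm d D c)) := by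
    simp only [toForm_apply, map_sum, monomial_homogExponent, Finset.mul_sum]
    refine Finset.sum_congr rfl fun p _ => ?_
    simp [he, jet, Derivation.leibniz_pow, Derivation.leibniz, pderiv_X]
    linear_combination -c p * (P.1 : ℂ) ^ p.1.1 * hz P.2 p.1.2
  have h11 : ∑ p : D, c p * jet P (1, 1) p =
      P.1 * (P.2 * e (pderiv 0 (pderiv 1 (toForm d D c)))) := by
    simp only [toForm_apply, map_sum, monomial_homogExponent, Finset.mul_sum]
    refine Finset.sum_congr rfl fun p _ => ?_
    simp [he, jet, Derivation.leibniz_pow, Derivation.leibniz, pderiv_X]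
    linear_combination -c p * p.1.2 * (P.2 : ℂ) ^ p.1.2 * hz P.1 p.1.1
      - c p * (P.1 * (p.1.1 * (P.1 : ℂ) ^ (p.1.1 - 1))) * hz P.2 p.1.2
  obtain ⟨u, v, huv⟩ := Ideal.mem_span_pair.1 hc
  revert k
  simp only [Prod.forall, Fin.forall_fin_two]
  rw [h00, h10, h01, h11, ← huv]
  simp [he, Derivation.leibniz_pow, Derivation.leibniz, pderiv_X]

/-- The lines of the 2-square at `P`. -/
noncomputable def squareLines (P : ℂˣ × ℂˣ) : Fin 2 → MvPolynomial (Fin 3) ℂ :=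
  ![X 0 - C (P.1 : ℂ) * X 2, X 1 - C (P.2 : ℂ) * X 2]

lemma isHomogeneous_squareLines (P : ℂˣ × ℂˣ) (j : Fin 2) :
    (squareLines P j).IsHomogeneous 1 := by
  fin_cases j <;> exact (isHomogeneous_X _ _).sub ((isHomogeneous_X _ _).C_mul _)

lemma linearIndependent_squareLines (P : ℂˣ × ℂˣ) : LinearIndependent ℂ (squareLines P) := by
  refine LinearIndependent.pair_iff.2 fun a b h => ⟨?_, ?_⟩
  · simpa using congrArg (eval ![1, 0, 0]) h
  · simpa using congrArg (eval ![0, 1, 0]) h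

lemma linearIndependent_X_zero_X_two :
    LinearIndependent ℂ (![X 0, X 2] : Fin 2 → MvPolynomial (Fin 3) ℂ) := by
  refine LinearIndependent.pair_iff.2 fun a b h => ⟨?_, ?_⟩
  · simpa using congrArg (eval ![1, 0, 0]) h
  · simpa using congrArg (eval ![0, 0, 1]) h

lemma eval_squareLines_eq_zero {P : ℂˣ × ℂˣ} {p : Fin 3 → ℂ} (h0 : eval p (squareLines P 0) = 0)
    (h1 : eval p (squareLines P 1) = 0) : p 0 = P.1 * p 2 ∧ p 1 = P.2 * p 2 := by
  simp only [squareLines, Matrix.cons_val_zero, Matrix.cons_val_one, eval_sub, eval_X, eval_mul,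
    eval_C, sub_eq_zero] at h0 h1
  exact ⟨h0, h1⟩

lemma ne_zero_of_eval_squareLines_eq_zero {P : ℂˣ × ℂˣ} {p : Fin 3 → ℂ} (hp : p ≠ 0)
    (h0 : eval p (squareLines P 0) = 0) (h1 : eval p (squareLines P 1) = 0) : p 2 ≠ 0 := by
  obtain ⟨h0, h1⟩ := eval_squareLines_eq_zero h0 h1
  intro h2
  rw [h2, mul_zero] at h0 h1
  refine hp (funext fun i => ?_)
  fin_cases i <;> assumption

lemma map_toForm_ker_jetMap (S : Finset (ℂˣ × ℂˣ)) (d : ℕ) :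
    (LinearMap.ker (jetMap S (truncatedTriangle (d + 1) (d - 2)))).map
        (toForm d (truncatedTriangle (d + 1) (d - 2))) =
      Submodule.restrictScalars ℂ ((⨅ P : S, squareIdeal P) ⊓ supportIdeal 3) ⊓
        homogeneousSubmodule (Fin 3) ℂ d := by
  have hD : ∀ p ∈ truncatedTriangle (d + 1) (d - 2), p.1 + p.2 ≤ d := fun p hp => by
    rw [mem_truncatedTriangle] at hp
    omega
  have hdeg : ∀ F ∈ homogeneousSubmodule (Fin 3) ℂ d, ∀ m ∈ F.support,
      m 0 + m 1 + m 2 = d := fun F hF m hm => by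
    simpa [Finsupp.weight_apply, Finsupp.sum_fintype, Fin.sum_univ_three]
      using hF (mem_support_iff.1 hm)
  ext F
  constructor
  · rintro ⟨c, hc, rfl⟩
    have hF := (range_toForm d _ hD).le ⟨c, rfl⟩
    refine ⟨⟨?_, fun m hm => ?_⟩, hF.1⟩
    · refine Ideal.mem_iInf.2 fun P => toForm_mem_squareIdeal hD P c fun k => ?_
      exact congrFun (LinearMap.mem_ker.1 hc) (P, k)
    · have h1 := hdeg _ hF.1 m hm
      have h2 := mem_truncatedTriangle.1 (hF.2 hm)
      omega
  · rintro ⟨⟨hF1, hF3⟩, hF⟩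
    obtain ⟨c, rfl⟩ := (range_toForm d _ hD).ge ⟨hF, fun m hm => by
      have h1 := hdeg _ hF m hm
      have h2 := hF3 m hm
      exact mem_truncatedTriangle.2 ⟨by dsimp only; omega, by dsimp only; omega⟩⟩
    refine ⟨c, LinearMap.mem_ker.2 (funext fun x => ?_), rfl⟩
    exact jet_eq_zero_of_mem_squareIdeal x.1 c (Ideal.mem_iInf.1 hF1 x.1) x.2

lemma hdim_eq_finrank_ker_jetMap (S : Finset (ℂˣ × ℂˣ)) (d : ℕ) :
    hdim ((⨅ P : S, squareIdeal P) ⊓ supportIdeal 3) d =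
      Module.finrank ℂ (LinearMap.ker (jetMap S (truncatedTriangle (d + 1) (d - 2)))) := by
  rw [hdim, ← map_toForm_ker_jetMap]
  exact (Submodule.equivMapOfInjective _ (toForm_injective _ _) _).finrank_eq.symm

lemma card_sub_eq_max (s d : ℕ) (hd : 1 ≤ d) :
    (((truncatedTriangle (d + 1) (d - 2)).card - 4 * s : ℕ) : ℤ) =
      max 0 (((d : ℤ) + 2) * ((d : ℤ) + 1) / 2 - 4 * (s : ℤ) - 6) := by
  obtain rfl | ⟨k, rfl⟩ : d = 1 ∨ ∃ k, d = k + 2 := by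
    rcases d with _ | _ | k
    · omega
    · exact Or.inl rfl
    · exact Or.inr ⟨k, rfl⟩
  · rw [show truncatedTriangle (1 + 1) (1 - 2) = ∅ by rfl]
    norm_num
    omega
  · have h := card_truncatedTriangle k
    rw [show k + 2 + 1 = k + 3 by ring, show k + 2 - 2 = k by omega]
    have h' : (((k + 2 : ℕ) : ℤ) + 2) * (((k + 2 : ℕ) : ℤ) + 1) =
        2 * (((truncatedTriangle (k + 3) k).card : ℤ) + 6) := by
      push_cast
      exact_mod_cast h.symm
    rw [h']
    omega

/-- A general union of `s` 2-squares and one 3-fat point in `ℙ²` has good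
postulation in degree `d`, for every `(s,d) ≠ (1,3)`. -/
theorem stmt_7 (s d : ℕ) (hs : 1 ≤ s) (hd : 1 ≤ d) (hsd : ¬ (s = 1 ∧ d = 3)) :
    ∃ (L : Fin s → Fin 2 → MvPolynomial (Fin 3) ℂ)
      (M : Fin 2 → MvPolynomial (Fin 3) ℂ),
      (∀ i j, (L i j).IsHomogeneous 1) ∧
      (∀ i, LinearIndependent ℂ (L i)) ∧
      (∀ j, (M j).IsHomogeneous 1) ∧
      LinearIndependent ℂ M ∧
      (∀ i j, i ≠ j →
        ∀ p : Fin 3 → ℂ, p ≠ 0 →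
          ¬ (eval p (L i 0) = 0 ∧ eval p (L i 1) = 0 ∧
             eval p (L j 0) = 0 ∧ eval p (L j 1) = 0)) ∧
      (∀ i, ∀ p : Fin 3 → ℂ, p ≠ 0 →
          ¬ (eval p (L i 0) = 0 ∧ eval p (L i 1) = 0 ∧
             eval p (M 0) = 0 ∧ eval p (M 1) = 0)) ∧
      (hdim ((⨅ i, Ideal.span {(L i 0) ^ 2, (L i 1) ^ 2}) ⊓
          (Ideal.span {M 0, M 1}) ^ 3) d : ℤ) =
        max 0 (((d : ℤ) + 2) * ((d : ℤ) + 1) / 2 - 4 * (s : ℤ) - 6) := by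
  obtain ⟨S, hS, h⟩ := exists_finrank_ker_jetMap s d hs hsd
  let e : Fin s ≃ S := (S.equivFinOfCardEq hS).symm
  refine ⟨fun i => squareLines (e i), ![X 0, X 2], fun i => isHomogeneous_squareLines _,
    fun i => linearIndependent_squareLines _, fun j => ?_, linearIndependent_X_zero_X_two, ?_, ?_,
    ?_⟩
  · fin_cases j <;> exact isHomogeneous_X _ _
  · rintro i j hij p hp ⟨hi0, hi1, hj0, hj1⟩
    have h2 := ne_zero_of_eval_squareLines_eq_zero hp hi0 hi1
    obtain ⟨hi0, hi1⟩ := eval_squareLines_eq_zero hi0 hi1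
    obtain ⟨hj0, hj1⟩ := eval_squareLines_eq_zero hj0 hj1
    refine hij (e.injective (Subtype.ext (Prod.ext (Units.ext ?_) (Units.ext ?_))))
    · exact mul_right_cancel₀ h2 (hi0.symm.trans hj0)
    · exact mul_right_cancel₀ h2 (hi1.symm.trans hj1)
  · rintro i p hp ⟨hi0, hi1, -, h2⟩
    exact ne_zero_of_eval_squareLines_eq_zero hp hi0 hi1 (by simpa using h2)
  · rw [← card_sub_eq_max s d hd, ← h, ← hdim_eq_finrank_ker_jetMap]
    have hinf : ⨅ i, Ideal.span {squareLines (e i) 0 ^ 2, squareLines (e i) 1 ^ 2} =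
        ⨅ P : S, squareIdeal P := e.iInf_congr fun _ => rfl
    have hspan : (Ideal.span {(![X 0, X 2] : Fin 2 → MvPolynomial (Fin 3) ℂ) 0,
        (![X 0, X 2] : Fin 2 → MvPolynomial (Fin 3) ℂ) 1}) ^ 3 = supportIdeal 3 :=
      span_pow_eq_supportIdeal 3
    rw [hinf, hspan]
end

section
/- Let L₁, L₂ ∈ ℂ[x,y,z] be linearly independent linear forms with common zero P ∈ ℙ², and let Q ∈ ℙ² be a point with L₁(Q) ≠ 0 and L₂(Q) ≠ 0. Let ℓ be a (nonzero) linear form vanishing at both P and Q, and let I(Q) ⊆ ℂ[x,y,z] be the ideal of Q. Then the degree-3 part of (L₁², L₂²) ∩ I(Q)³ is the 1-dimensional space ℂ·ℓ³; in particular dim_ℂ ( (L₁², L₂²) ∩ I(Q)³ )_3 = 1, and not 0 as expected. (This is the exceptional case (s,d) = (1,3) of the theorem on a general union of 2-squares and a 3-fat point: the unique cubic through a general 2-square and a general triple point is the cube of the line joining their supports.) -/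
open MvPolynomial

/-- The homogeneous ideal of the point of `ℙ²` with coordinates `Q`: the ideal
generated by all linear forms vanishing at `Q`. -/
noncomputable def pointIdeal (Q : Fin 3 → ℂ) : Ideal (MvPolynomial (Fin 3) ℂ) :=
  Ideal.span {f : MvPolynomial (Fin 3) ℂ | f.IsHomogeneous 1 ∧ eval Q f = 0}

namespace MvPolynomial

/-- In degree `m + n`, multiplying by a form of degree `n` only sees the degree-`m` part. -/
lemma homogeneousComponent_mul_of_isHomogeneous {σ R : Type*} [CommSemiring R] {m n : ℕ}
    (p : MvPolynomial σ R) {q : MvPolynomial σ R} (hq : q.IsHomogeneous n) :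
    homogeneousComponent (m + n) (p * q) = homogeneousComponent m p * q := by
  classical
  let _ := gradedAlgebra (σ := σ) (R := R)
  have h := DirectSum.coe_decompose_mul_of_right_mem_of_le (homogeneousSubmodule σ R)
    (a := p) (n := m + n) hq (Nat.le_add_left n m)
  rw [Nat.add_sub_cancel] at h
  simpa only [← decomposition.decompose'_apply] using! h

/-- A linear form evaluates as a linear functional. -/
lemma IsHomogeneous.exists_dual_eval {σ R : Type*} [CommSemiring R] {L : MvPolynomial σ R}
    (hL : L.IsHomogeneous 1) : ∃ φ : Module.Dual R (σ → R), ∀ v, eval v L = φ v := by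
  rw [← mem_homogeneousSubmodule, homogeneousSubmodule_one_eq_span_X] at hL
  induction hL using Submodule.span_induction with
  | mem x hx =>
    obtain ⟨i, rfl⟩ := hx
    exact ⟨LinearMap.proj i, fun v => by simp⟩
  | zero => exact ⟨0, fun v => by simp⟩
  | add x y _ _ hx hy =>
    obtain ⟨φ, hφ⟩ := hx
    obtain ⟨ψ, hψ⟩ := hy
    exact ⟨φ + ψ, fun v => by simp [hφ, hψ]⟩
  | smul c x _ hx =>
    obtain ⟨φ, hφ⟩ := hx
    exact ⟨c • φ, fun v => by simp [hφ, smul_eval]⟩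

end MvPolynomial

/-- A cubic with a triple point at `Q` is a cone with vertex `Q`. -/
lemma eval_add_smul_of_mem_pointIdeal_pow {Q : Fin 3 → ℂ} {f : MvPolynomial (Fin 3) ℂ}
    (hf : f ∈ pointIdeal Q ^ 3) (hf3 : f.IsHomogeneous 3) (v : Fin 3 → ℂ) (t : ℂ) :
    eval (v + t • Q) f = eval v f := by
  suffices h : eval (v + t • Q) (homogeneousComponent 3 f) =
      eval v (homogeneousComponent 3 f) by
    rwa [homogeneousComponent_eq_self hf3] at h
  clear hf3
  suffices h : ∀ g, eval (v + t • Q) (homogeneousComponent 3 (g * f)) =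
      eval v (homogeneousComponent 3 (g * f)) by
    simpa using h 1
  have inv : ∀ a : MvPolynomial (Fin 3) ℂ, a.IsHomogeneous 1 ∧ eval Q a = 0 →
      eval (v + t • Q) a = eval v a := by
    rintro a ⟨ha, haQ⟩
    obtain ⟨φ, hφ⟩ := ha.exists_dual_eval
    rw [hφ] at haQ
    simp [hφ, haQ]
  rw [pow_succ, pow_two, pointIdeal, Ideal.span_mul_span', Ideal.span_mul_span'] at hf
  induction hf using Submodule.span_induction with
  | mem x hx =>
    obtain ⟨_, ⟨a, ha, b, hb, rfl⟩, c, hc, rfl⟩ := hx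
    have habc : (a * b * c).IsHomogeneous 3 := (ha.1.mul hb.1).mul hc.1
    intro g
    have hg := homogeneousComponent_mul_of_isHomogeneous (m := 0) g habc
    rw [zero_add, homogeneousComponent_zero] at hg
    simp only [hg, map_mul, eval_C, inv a ha, inv b hb, inv c hc]
  | zero => simp
  | add x y _ _ hx hy => simp only [mul_add, map_add, hx, hy, implies_true]
  | smul r x _ hx => exact fun g => by simpa [mul_assoc] using hx (g * r)

/-- The linear forms vanishing at a point are spanned by any two independent ones. -/
lemma exists_eq_add_of_apply_eq_zero {K : Type*} [Field K] {φ₁ φ₂ : Module.Dual K (Fin 3 → K)}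
    (hind : LinearIndependent K ![φ₁, φ₂]) {P : Fin 3 → K} (hP : P ≠ 0)
    (h₁ : φ₁ P = 0) (h₂ : φ₂ P = 0) {ψ : Module.Dual K (Fin 3 → K)} (hψ : ψ P = 0) :
    ∃ a b : K, ∀ v, ψ v = a * φ₁ v + b * φ₂ v := by
  have hle : Submodule.span K (Set.range ![φ₁, φ₂]) ≤
      (Submodule.span K {P}).dualAnnihilator := by
    rw [Submodule.span_le]
    rintro _ ⟨i, rfl⟩
    rw [SetLike.mem_coe, Submodule.mem_dualAnnihilator]
    intro w hw
    obtain ⟨c, rfl⟩ := Submodule.mem_span_singleton.1 hw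
    fin_cases i <;> simp [h₁, h₂]
  have hrank := Subspace.finrank_add_finrank_dualAnnihilator_eq (Submodule.span K {P})
  rw [finrank_span_singleton hP, Module.finrank_fin_fun] at hrank
  have heq := Submodule.eq_of_le_of_finrank_eq hle (by
    rw [finrank_span_eq_card hind, Fintype.card_fin]
    omega)
  have hmem : ψ ∈ Submodule.span K (Set.range ![φ₁, φ₂]) := by
    rw [heq, Submodule.mem_dualAnnihilator]
    intro w hw
    obtain ⟨c, rfl⟩ := Submodule.mem_span_singleton.1 hw
    simp [hψ]
  rw [Matrix.range_cons, Matrix.range_cons, Matrix.range_empty, Set.union_empty,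
    Set.singleton_union, Submodule.mem_span_pair] at hmem
  obtain ⟨a, b, rfl⟩ := hmem
  exact ⟨a, b, fun v => by simp⟩

/-- The exceptional case `(s,d) = (1,3)`: the unique cubic through a general
2-square and a general triple point is the cube of the line joining their
supports. -/
theorem stmt_8 (L₁ L₂ : MvPolynomial (Fin 3) ℂ)
    (h₁ : L₁.IsHomogeneous 1) (h₂ : L₂.IsHomogeneous 1)
    (hind : LinearIndependent ℂ ![L₁, L₂])
    (P : Fin 3 → ℂ) (hP : P ≠ 0) (hP₁ : eval P L₁ = 0) (hP₂ : eval P L₂ = 0)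
    (Q : Fin 3 → ℂ) (hQ : Q ≠ 0) (hQ₁ : eval Q L₁ ≠ 0) (hQ₂ : eval Q L₂ ≠ 0)
    (ℓ : MvPolynomial (Fin 3) ℂ) (hℓhom : ℓ.IsHomogeneous 1) (hℓ0 : ℓ ≠ 0)
    (hℓP : eval P ℓ = 0) (hℓQ : eval Q ℓ = 0) :
    (Submodule.restrictScalars ℂ
        (Ideal.span {L₁ ^ 2, L₂ ^ 2} ⊓ (pointIdeal Q) ^ 3) ⊓
      homogeneousSubmodule (Fin 3) ℂ 3 =
        Submodule.span ℂ ({ℓ ^ 3} : Set (MvPolynomial (Fin 3) ℂ))) ∧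
    hdim (Ideal.span {L₁ ^ 2, L₂ ^ 2} ⊓ (pointIdeal Q) ^ 3) 3 = 1 := by
  obtain ⟨φ₁, hφ₁⟩ := h₁.exists_dual_eval
  obtain ⟨φ₂, hφ₂⟩ := h₂.exists_dual_eval
  obtain ⟨ψ, hψ⟩ := hℓhom.exists_dual_eval
  rw [hφ₁] at hP₁ hQ₁
  rw [hφ₂] at hP₂ hQ₂
  rw [hψ] at hℓP hℓQ
  have hindφ : LinearIndependent ℂ ![φ₁, φ₂] := by
    rw [LinearIndependent.pair_iff] at hind ⊢
    intro s t hst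
    refine hind s t (MvPolynomial.funext fun v => ?_)
    simpa [smul_eval, hφ₁, hφ₂] using LinearMap.congr_fun hst v
  obtain ⟨α, β, hαβ⟩ := exists_eq_add_of_apply_eq_zero hindφ hP hP₁ hP₂ hℓP
  have hℓ : ℓ = C α * L₁ + C β * L₂ :=
    MvPolynomial.funext fun v => by simp [hφ₁, hφ₂, hψ, hαβ]
  have hQαβ : α * φ₁ Q + β * φ₂ Q = 0 := by rw [← hαβ, hℓQ]
  have hα : α ≠ 0 := by
    rintro rfl
    have hβ : β = 0 := by simpa [hQ₂] using hQαβ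
    exact hℓ0 (by simp [hℓ, hβ])
  have key : Submodule.restrictScalars ℂ (Ideal.span {L₁ ^ 2, L₂ ^ 2} ⊓ (pointIdeal Q) ^ 3) ⊓
      homogeneousSubmodule (Fin 3) ℂ 3 =
        Submodule.span ℂ ({ℓ ^ 3} : Set (MvPolynomial (Fin 3) ℂ)) := by
    apply le_antisymm
    · rintro f ⟨⟨hfL, hfQ⟩, hf3⟩
      rw [SetLike.mem_coe, mem_homogeneousSubmodule] at hf3
      have inv := eval_add_smul_of_mem_pointIdeal_pow hfQ hf3
      obtain ⟨g, h, hgh⟩ := Ideal.mem_span_pair.1 hfL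
      obtain ⟨A, hA⟩ := (homogeneousComponent_isHomogeneous 1 g).exists_dual_eval
      obtain ⟨B, hB⟩ := (homogeneousComponent_isHomogeneous 1 h).exists_dual_eval
      have hf : ∀ v, eval v f = A v * φ₁ v ^ 2 + B v * φ₂ v ^ 2 := by
        intro v
        rw [← homogeneousComponent_eq_self hf3, ← hgh, map_add,
          homogeneousComponent_mul_of_isHomogeneous (m := 1) g (h₁.pow 2),
          homogeneousComponent_mul_of_isHomogeneous (m := 1) h (h₂.pow 2)]
        simp [hA, hB, hφ₁, hφ₂]
      have polar : ∀ v (t : ℂ), A P * φ₁ (v + t • Q) ^ 2 + B P * φ₂ (v + t • Q) ^ 2 =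
          A P * φ₁ v ^ 2 + B P * φ₂ v ^ 2 := by
        intro v t
        have e₁ := inv v t
        have e₂ := inv (v + P) t
        simp only [hf, map_add, map_smul, smul_eq_mul, hP₁, hP₂] at e₁ e₂ ⊢
        linear_combination e₂ - e₁
      obtain ⟨w, hw₁, hw₂⟩ : ∃ w, φ₁ w = 0 ∧ φ₂ w ≠ 0 := by
        by_contra! hker
        have hdep := LinearIndependent.pair_iff.1 hindφ (φ₂ Q) (-φ₁ Q) (by
          refine LinearMap.ext fun v => ?_
          have := hker (φ₁ Q • v - φ₁ v • Q) (by simp [mul_comm])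
          simp only [map_sub, map_smul, smul_eq_mul] at this
          simp only [LinearMap.add_apply, LinearMap.smul_apply, LinearMap.zero_apply, smul_eq_mul]
          linear_combination -this)
        exact hQ₂ hdep.1
      have hBP : B P = 0 := by
        have e₁ := polar 0 1
        have e₂ := polar w 1
        simp only [map_add, map_smul, map_zero, smul_eq_mul, hw₁] at e₁ e₂
        have : B P * (2 * φ₂ w * φ₂ Q) = 0 := by linear_combination e₂ - e₁
        simpa [hw₂, hQ₂] using this
      have hAP : A P = 0 := by
        simpa [hBP, hQ₁] using polar 0 1
      obtain ⟨a, b, hab⟩ := exists_eq_add_of_apply_eq_zero hindφ hP hP₁ hP₂ hAP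
      refine Submodule.mem_span_singleton.2 ⟨a / α ^ 3, MvPolynomial.funext fun v => ?_⟩
      have hφ₂0 : φ₂ (v + (-(φ₂ v / φ₂ Q)) • Q) = 0 := by
        simp [hQ₂]
      have hφ₁v : φ₁ (v + (-(φ₂ v / φ₂ Q)) • Q) = ψ v / α := by
        rw [hαβ]
        simp only [map_add, map_smul, smul_eq_mul]
        field_simp
        linear_combination -φ₂ v * hQαβ
      rw [← inv v (-(φ₂ v / φ₂ Q)), hf, hab, hφ₂0, hφ₁v, smul_eval, map_pow, hψ]
      field_simp
      ring
    · rw [Submodule.span_singleton_le_iff_mem]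
      refine ⟨⟨?_, ?_⟩, ?_⟩
      · refine Ideal.mem_span_pair.2 ⟨C α ^ 3 * L₁ + 3 * C α ^ 2 * C β * L₂,
          3 * C α * C β ^ 2 * L₁ + C β ^ 3 * L₂, ?_⟩
        rw [hℓ]
        ring
      · have hℓI : ℓ ∈ pointIdeal Q := Ideal.subset_span ⟨hℓhom, by rw [hψ, hℓQ]⟩
        exact Ideal.pow_mem_pow hℓI 3
      · exact hℓhom.pow 3
  refine ⟨key, ?_⟩
  rw [hdim, key, finrank_span_singleton (pow_ne_zero 3 hℓ0)]
end

section
/- For every t ∈ ℂ with t ≠ 0, one has the following equality of ideals in ℂ[x,y,z]: (x², y²) ∩ ((x+tz)², (y+tz)²) = ( 2x²y − 2xy² + t x²z − t y²z, 2x³ − 2y³ + 3t x²z − 3t y²z, y⁴ + 2t y³z + t² y²z² ). -/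
open MvPolynomial

local notation "x" => (X 0 : MvPolynomial (Fin 3) ℂ)
local notation "y" => (X 1 : MvPolynomial (Fin 3) ℂ)
local notation "z" => (X 2 : MvPolynomial (Fin 3) ℂ)

/-- The ideal generated by the three cubic and quartic forms, i.e. the right-hand side of
`stmt_9`. -/
noncomputable def unionIdeal (t : ℂ) : Ideal (MvPolynomial (Fin 3) ℂ) :=
  Ideal.span
      {2 * x ^ 2 * y - 2 * x * y ^ 2 + C t * x ^ 2 * z - C t * y ^ 2 * z,
       2 * x ^ 3 - 2 * y ^ 3 + 3 * (C t) * x ^ 2 * z - 3 * (C t) * y ^ 2 * z,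
       y ^ 4 + 2 * (C t) * y ^ 3 * z + (C t) ^ 2 * y ^ 2 * z ^ 2}

theorem mem_unionIdeal {t : ℂ} {p : MvPolynomial (Fin 3) ℂ} :
    p ∈ unionIdeal t ↔ ∃ a b c,
      a * (2 * x ^ 2 * y - 2 * x * y ^ 2 + C t * x ^ 2 * z - C t * y ^ 2 * z) +
      (b * (2 * x ^ 3 - 2 * y ^ 3 + 3 * (C t) * x ^ 2 * z - 3 * (C t) * y ^ 2 * z) +
      c * (y ^ 4 + 2 * (C t) * y ^ 3 * z + (C t) ^ 2 * y ^ 2 * z ^ 2)) = p := by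
  simp only [unionIdeal, Ideal.mem_span_insert, Ideal.mem_span_singleton']
  constructor
  · rintro ⟨a, _, ⟨b, _, ⟨c, rfl⟩, rfl⟩, rfl⟩
    exact ⟨a, b, c, rfl⟩
  · rintro ⟨a, b, c, rfl⟩
    exact ⟨a, _, ⟨b, _, ⟨c, rfl⟩, rfl⟩, rfl⟩

/-- The combination of `x²`, `y²`, `xy²`, `y³` with coefficients in `ℂ[z]`. -/
noncomputable def normalForm (c : Fin 4 → Polynomial ℂ) : MvPolynomial (Fin 3) ℂ :=
  Polynomial.aeval z (c 0) * x ^ 2 + Polynomial.aeval z (c 1) * y ^ 2 +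
    Polynomial.aeval z (c 2) * (x * y ^ 2) + Polynomial.aeval z (c 3) * y ^ 3

theorem normalForm_add (c d : Fin 4 → Polynomial ℂ) :
    normalForm (c + d) = normalForm c + normalForm d := by
  simp only [normalForm, Pi.add_apply, map_add]
  ring

theorem two_mul_C_half : (2 : MvPolynomial (Fin 3) ℂ) * C (1 / 2) = 1 := by
  rw [← map_ofNat (C : ℂ →+* MvPolynomial (Fin 3) ℂ) 2, ← C_mul]
  norm_num

theorem exists_X_zero_mul_normalForm (t : ℂ) (c : Fin 4 → Polynomial ℂ) :
    ∃ d, x * normalForm c - normalForm d ∈ unionIdeal t := by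
  set h : MvPolynomial (Fin 3) ℂ := C (1 / 2) with h_def
  have hh : 2 * h = 1 := two_mul_C_half
  let k : Polynomial ℂ := Polynomial.C (1 / 2)
  let w : Polynomial ℂ := Polynomial.C t * Polynomial.X
  let A : Fin 4 → MvPolynomial (Fin 3) ℂ := fun i => Polynomial.aeval z (c i)
  refine ⟨![-3 * k * w * c 0 - k ^ 2 * w ^ 2 * c 3,
      3 * k * w * c 0 - w ^ 2 * c 2 - 3 * k ^ 2 * w ^ 2 * c 3,
      c 1 - 2 * w * c 2 - 3 * k * w * c 3,
      c 0 - k * w * c 3], mem_unionIdeal.2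
    ⟨-(h * x + 3 * h ^ 2 * (C t * z)) * A 2 - h * (x + y + C t * z) * A 3,
      h * A 0 + (h * y + h ^ 2 * (C t * z)) * (A 2 + A 3), A 2 + A 3, ?_⟩⟩
  simp only [normalForm, Matrix.cons_val, map_sub, map_mul, map_neg, map_pow,
    Polynomial.aeval_X, Polynomial.aeval_C, map_ofNat, k, w, A, algebraMap_eq, ← h_def]
  generalize Polynomial.aeval z (c 0) = c0
  generalize Polynomial.aeval z (c 1) = c1
  generalize Polynomial.aeval z (c 2) = c2
  generalize Polynomial.aeval z (c 3) = c3
  clear_value h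
  generalize (C t : MvPolynomial (Fin 3) ℂ) = s
  generalize x = u, y = v, z = r
  grind

theorem exists_X_one_mul_normalForm (t : ℂ) (c : Fin 4 → Polynomial ℂ) :
    ∃ d, y * normalForm c - normalForm d ∈ unionIdeal t := by
  set h : MvPolynomial (Fin 3) ℂ := C (1 / 2) with h_def
  have hh : 2 * h = 1 := two_mul_C_half
  let k : Polynomial ℂ := Polynomial.C (1 / 2)
  let w : Polynomial ℂ := Polynomial.C t * Polynomial.X
  let A : Fin 4 → MvPolynomial (Fin 3) ℂ := fun i => Polynomial.aeval z (c i)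
  refine ⟨![-k * w * c 0 - k ^ 2 * w ^ 2 * c 2,
      k * w * c 0 - 3 * k ^ 2 * w ^ 2 * c 2 - w ^ 2 * c 3,
      c 0 - 3 * k * w * c 2,
      c 1 - k * w * c 2 - 2 * w * c 3], mem_unionIdeal.2
    ⟨h * A 0 - h * (x + y + C t * z) * A 2,
      (h * y + h ^ 2 * (C t * z)) * A 2, A 2 + A 3, ?_⟩⟩
  simp only [normalForm, Matrix.cons_val, map_sub, map_mul, map_neg, map_pow,
    Polynomial.aeval_X, Polynomial.aeval_C, map_ofNat, k, w, A, algebraMap_eq, ← h_def]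
  generalize Polynomial.aeval z (c 0) = c0
  generalize Polynomial.aeval z (c 1) = c1
  generalize Polynomial.aeval z (c 2) = c2
  generalize Polynomial.aeval z (c 3) = c3
  clear_value h
  generalize (C t : MvPolynomial (Fin 3) ℂ) = s
  generalize x = u, y = v, z = r
  grind

theorem exists_mul_normalForm (t : ℂ) (p : MvPolynomial (Fin 3) ℂ) (c : Fin 4 → Polynomial ℂ) :
    ∃ d, p * normalForm c - normalForm d ∈ unionIdeal t := by
  induction p using MvPolynomial.induction_on generalizing c with
  | C a =>
    refine ⟨fun i => Polynomial.C a * c i, ?_⟩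
    convert (unionIdeal t).zero_mem using 1
    simp only [normalForm, map_mul, Polynomial.aeval_C, algebraMap_eq]
    ring
  | add p q hp hq =>
    obtain ⟨d, hd⟩ := hp c
    obtain ⟨e, he⟩ := hq c
    refine ⟨d + e, ?_⟩
    convert add_mem hd he using 1
    rw [normalForm_add]
    ring
  | mul_X p n hp =>
    have hX : ∃ d, X n * normalForm c - normalForm d ∈ unionIdeal t := by
      fin_cases n
      · exact exists_X_zero_mul_normalForm t c
      · exact exists_X_one_mul_normalForm t c
      · refine ⟨fun i => Polynomial.X * c i, ?_⟩
        convert (unionIdeal t).zero_mem using 1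
        simp only [normalForm, map_mul, Polynomial.aeval_X, Fin.reduceFinMk]
        ring
    obtain ⟨d, hd⟩ := hX
    obtain ⟨e, he⟩ := hp d
    refine ⟨e, ?_⟩
    convert add_mem ((unionIdeal t).mul_mem_left p hd) he using 1
    ring

theorem exists_normalForm_of_mem {t : ℂ} {p : MvPolynomial (Fin 3) ℂ}
    (hp : p ∈ Ideal.span {x ^ 2, y ^ 2}) : ∃ d, p - normalForm d ∈ unionIdeal t := by
  obtain ⟨a, b, rfl⟩ := Ideal.mem_span_pair.1 hp
  obtain ⟨d, hd⟩ := exists_mul_normalForm t a ![1, 0, 0, 0]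
  obtain ⟨e, he⟩ := exists_mul_normalForm t b ![0, 1, 0, 0]
  refine ⟨d + e, ?_⟩
  convert add_mem hd he using 1
  rw [normalForm_add]
  simp [normalForm]
  ring

theorem pderiv_aeval_X {i j : Fin 3} (hij : j ≠ i) (c : Polynomial ℂ) :
    pderiv i (Polynomial.aeval (X j : MvPolynomial (Fin 3) ℂ) c) = 0 := by
  rw [Derivation.map_aeval, pderiv_X_of_ne hij, smul_zero]

/-- A polynomial in the ideal of the 2-square at `[-t:-t:1]` vanishes along the corresponding line,
together with its derivatives in `x`, in `y`, and in both. -/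
theorem normalForm_eq_zero_of_mem {t : ℂ} (ht : t ≠ 0) {c : Fin 4 → Polynomial ℂ}
    (hc : normalForm c ∈ Ideal.span {(x + C t * z) ^ 2, (y + C t * z) ^ 2}) :
    normalForm c = 0 := by
  obtain ⟨a, b, hab⟩ := Ideal.mem_span_pair.1 hc
  let w : Polynomial ℂ := Polynomial.C t * Polynomial.X
  have hw : w ≠ 0 := mul_ne_zero (Polynomial.C_ne_zero.2 ht) Polynomial.X_ne_zero
  let e : MvPolynomial (Fin 3) ℂ →ₐ[ℂ] Polynomial ℂ := aeval ![-w, -w, Polynomial.X]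
  have e0 : e x = -w := by simp [e]
  have e1 : e y = -w := by simp [e]
  have e2 : e z = Polynomial.X := by simp [e]
  have eC (s : ℂ) : e (C s) = Polynomial.C s := by simp [e]
  have ec (p : Polynomial ℂ) : e (Polynomial.aeval z p) = p := by
    rw [← Polynomial.aeval_algHom_apply, e2, Polynomial.aeval_X_left_apply]
  have d0 (p : Polynomial ℂ) : pderiv 0 (Polynomial.aeval z p) = 0 :=
    pderiv_aeval_X (by decide) p
  have d1 (p : Polynomial ℂ) : pderiv 1 (Polynomial.aeval z p) = 0 :=
    pderiv_aeval_X (by decide) p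
  have h1 := congrArg e hab
  have hx := congrArg (fun p => e (pderiv 0 p)) hab
  have hy := congrArg (fun p => e (pderiv 1 p)) hab
  have hxy := congrArg (fun p => e (pderiv 0 (pderiv 1 p))) hab
  have p01 : pderiv 0 y = 0 := pderiv_X_of_ne (by decide)
  have p02 : pderiv 0 z = 0 := pderiv_X_of_ne (by decide)
  have p10 : pderiv 1 x = 0 := pderiv_X_of_ne (by decide)
  have p12 : pderiv 1 z = 0 := pderiv_X_of_ne (by decide)
  simp only [normalForm, pow_succ, pow_zero, one_mul, map_add, map_mul, Derivation.leibniz,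
    smul_eq_mul, pderiv_C, pderiv_X_self, p01, p02, p10, p12, d0, d1, map_zero, map_one,
    Derivation.map_one_eq_zero, e0, e1, e2, eC, ec]
    at h1 hx hy hxy
  have hw' : Polynomial.C t * Polynomial.X = w := rfl
  simp only [hw'] at h1 hx hy hxy
  have c2 : c 2 = 0 := by
    have : w * (2 * c 2) = 0 := by linear_combination hxy
    simpa [hw] using this
  have c0 : c 0 = 0 := by
    have : w * (2 * c 0) = 0 := by linear_combination hx + w ^ 2 * c2
    simpa [hw] using this
  have c3 : c 3 = 0 := by
    have : w ^ 3 * c 3 = 0 := by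
      linear_combination -2 * h1 - w * hy - 2 * w ^ 2 * c0
    simpa [hw] using this
  have c1 : c 1 = 0 := by
    have : w * (2 * c 1) = 0 := by linear_combination hy + 2 * w ^ 2 * c2 + 3 * w ^ 2 * c3
    simpa [hw] using this
  simp [normalForm, c0, c1, c2, c3]

theorem unionIdeal_le_left (t : ℂ) : unionIdeal t ≤ Ideal.span {x ^ 2, y ^ 2} := by
  intro p hp
  obtain ⟨a, b, c, rfl⟩ := mem_unionIdeal.1 hp
  refine Ideal.mem_span_pair.2
    ⟨a * (2 * y + C t * z) + b * (2 * x + 3 * (C t * z)),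
      -a * (2 * x + C t * z) - b * (2 * y + 3 * (C t * z)) + c * (y + C t * z) ^ 2, ?_⟩
  ring

theorem unionIdeal_le_right (t : ℂ) :
    unionIdeal t ≤ Ideal.span {(x + C t * z) ^ 2, (y + C t * z) ^ 2} := by
  intro p hp
  obtain ⟨a, b, c, rfl⟩ := mem_unionIdeal.1 hp
  refine Ideal.mem_span_pair.2
    ⟨a * (2 * y + C t * z) + b * (2 * x - C t * z),
      -a * (2 * x + C t * z) - b * (2 * y - C t * z) + c * y ^ 2, ?_⟩
  ring

/-- The ideal of the union of the two 2-squares `(x², y²)` and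
`((x+tz)², (y+tz)²)` (for `t ≠ 0`), whose limit as `t → 0` is the flat limit of
two colliding 2-squares. -/
theorem stmt_9 (t : ℂ) (ht : t ≠ 0) :
    Ideal.span {x ^ 2, y ^ 2} ⊓
      Ideal.span {(x + C t * z) ^ 2, (y + C t * z) ^ 2} =
    Ideal.span
      {2 * x ^ 2 * y - 2 * x * y ^ 2 + C t * x ^ 2 * z - C t * y ^ 2 * z,
       2 * x ^ 3 - 2 * y ^ 3 + 3 * (C t) * x ^ 2 * z - 3 * (C t) * y ^ 2 * z,
       y ^ 4 + 2 * (C t) * y ^ 3 * z + (C t) ^ 2 * y ^ 2 * z ^ 2} := by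
  refine le_antisymm ?_ (le_inf (unionIdeal_le_left t) (unionIdeal_le_right t))
  rintro p ⟨hI, hJ⟩
  obtain ⟨d, hd⟩ := exists_normalForm_of_mem (t := t) hI
  have hzero : normalForm d = 0 := normalForm_eq_zero_of_mem ht <| by
    simpa using sub_mem hJ (unionIdeal_le_right t hd)
  rwa [hzero, sub_zero] at hd
end

section
/- In ℂ[x,y,z], the ideal Y = (x²y − xy², x³ − y³, y⁴) satisfies: (i) Y + (y) = (x³, y), and (ii) Y : (y) = (x² − xy, xy², y³). -/
open MvPolynomial

local notation "x" => (X 0 : MvPolynomial (Fin 3) ℂ)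
local notation "y" => (X 1 : MvPolynomial (Fin 3) ℂ)
local notation "z" => (X 2 : MvPolynomial (Fin 3) ℂ)

theorem X_one_dvd_of_dvd_mul_X_zero_pow {b : MvPolynomial (Fin 3) ℂ} (n : ℕ)
    (h : y ∣ b * x ^ n) : y ∣ b := by
  have hp : Prime y := X_prime
  refine (hp.dvd_or_dvd h).resolve_right fun hd => ?_
  simpa [X_dvd_X] using hp.dvd_of_dvd_pow hd

/-- Trace and residue with respect to the line `r : y = 0` of the ideal
`Y = (x²y − xy², x³ − y³, y⁴)` of the flat limit of two colliding 2-squares. -/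
theorem stmt_10 :
    (Ideal.span {x ^ 2 * y - x * y ^ 2, x ^ 3 - y ^ 3, y ^ 4} ⊔
        Ideal.span {y} = Ideal.span {x ^ 3, y}) ∧
    (Ideal.span {x ^ 2 * y - x * y ^ 2, x ^ 3 - y ^ 3, y ^ 4}).colon
        (Ideal.span {y}) =
      Ideal.span {x ^ 2 - x * y, x * y ^ 2, y ^ 3} := by
  constructor
  · apply le_antisymm
    · rw [sup_le_iff, Ideal.span_le, Ideal.span_le]
      constructor
      · rintro _ (rfl | rfl | rfl) <;> rw [SetLike.mem_coe, Ideal.mem_span_pair]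
        · exact ⟨0, x ^ 2 - x * y, by ring⟩
        · exact ⟨1, -y ^ 2, by ring⟩
        · exact ⟨0, y ^ 3, by ring⟩
      · rintro _ rfl
        exact Ideal.subset_span (by simp)
    · rw [Ideal.span_le, ← Ideal.span_union]
      rintro _ (rfl | rfl)
      · have hy : y ^ 3 ∈ Ideal.span
            ({x ^ 2 * y - x * y ^ 2, x ^ 3 - y ^ 3, y ^ 4} ∪ {y}) :=
          Ideal.pow_mem_of_mem _ (Ideal.subset_span (by simp)) 3 (by norm_num)
        exact (Submodule.sub_mem_iff_left _ hy).1 (Ideal.subset_span (by simp))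
      · exact Ideal.subset_span (by simp)
  · ext f
    rw [Ideal.mem_colon_span_singleton, Ideal.span, Ideal.span, Submodule.mem_span_triple,
      Submodule.mem_span_triple]
    simp only [smul_eq_mul]
    constructor
    · rintro ⟨a, b, c, h⟩
      obtain ⟨d, rfl⟩ : y ∣ b := X_one_dvd_of_dvd_mul_X_zero_pow 3
        ⟨f - a * (x ^ 2 - x * y) + b * y ^ 2 - c * y ^ 3, by linear_combination h⟩
      refine ⟨a + d * (x + y), d, c - d, mul_right_cancel₀ (X_ne_zero 1 : y ≠ 0) ?_⟩
      linear_combination h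
    · rintro ⟨a, b, c, rfl⟩
      exact ⟨a - b * (x + y), b * y, b + c, by ring⟩
end

section
/- In ℂ[x,y,z], the ideal I = (x² − xy, xy², y³) satisfies: (i) I + (y) = (x², y), and (ii) I : (y) = (x, y)². -/
open MvPolynomial

local notation "x" => (X 0 : MvPolynomial (Fin 3) ℂ)
local notation "y" => (X 1 : MvPolynomial (Fin 3) ℂ)
local notation "z" => (X 2 : MvPolynomial (Fin 3) ℂ)

lemma Ideal.span_triple_sup_span_singleton {R : Type*} [CommRing R] (a b : R) :
    Ideal.span {a ^ 2 - a * b, a * b ^ 2, b ^ 3} ⊔ Ideal.span {b} = Ideal.span {a ^ 2, b} := by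
  apply le_antisymm
  · rw [sup_le_iff, Ideal.span_le, Ideal.span_singleton_le_iff_mem]
    simp only [Set.insert_subset_iff, Set.singleton_subset_iff, SetLike.mem_coe,
      Ideal.mem_span_pair]
    exact ⟨⟨⟨1, -a, by ring⟩, ⟨0, a * b, by ring⟩, ⟨0, b ^ 2, by ring⟩⟩, ⟨0, 1, by ring⟩⟩
  · have hb : b ∈ Ideal.span {a ^ 2 - a * b, a * b ^ 2, b ^ 3} ⊔ Ideal.span {b} :=
      Ideal.mem_sup_right (Ideal.mem_span_singleton_self b)
    have ha : a ^ 2 - a * b ∈ Ideal.span {a ^ 2 - a * b, a * b ^ 2, b ^ 3} ⊔ Ideal.span {b} :=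
      Ideal.mem_sup_left (Ideal.subset_span (by simp))
    rw [Ideal.span_le, Set.insert_subset_iff, Set.singleton_subset_iff]
    refine ⟨?_, hb⟩
    simpa using add_mem ha (Ideal.mul_mem_left _ a hb)

lemma Ideal.span_pair_sq {R : Type*} [CommRing R] (a b : R) :
    Ideal.span {a, b} ^ 2 = Ideal.span {a ^ 2, a * b, b ^ 2} := by
  rw [sq, Ideal.span_pair_mul_span_pair, mul_comm b a, Set.insert_idem, sq, sq]

lemma Ideal.span_triple_colon_span_singleton {R : Type*} [CommRing R] [IsDomain R] {a b : R}
    (hb : Prime b) (hab : ¬ b ∣ a) :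
    (Ideal.span {a ^ 2 - a * b, a * b ^ 2, b ^ 3}).colon (Ideal.span {b} : Ideal R) =
      Ideal.span {a, b} ^ 2 := by
  rw [Ideal.span_pair_sq]
  ext f
  rw [Ideal.span, Ideal.span, Ideal.span, Submodule.colon_span, Submodule.mem_colon_singleton,
    smul_eq_mul]
  simp only [Submodule.mem_span_triple, smul_eq_mul]
  constructor
  · rintro ⟨u, v, w, h⟩
    have hdvd : b ∣ u * a ^ 2 :=
      ⟨f + u * a - v * a * b - w * b ^ 2, by linear_combination h⟩
    obtain ⟨t, rfl⟩ := (hb.dvd_or_dvd hdvd).resolve_right fun h2 => hab (hb.dvd_of_dvd_pow h2)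
    exact ⟨t, v - t, w, mul_right_cancel₀ hb.ne_zero (by linear_combination h)⟩
  · rintro ⟨u, v, w, rfl⟩
    exact ⟨u * b, u + v, w, by ring⟩

/-- Trace and residue with respect to the line `r : y = 0` of the ideal
`I = (x² − xy, xy², y³)`, the first residue of the flat limit of two colliding
2-squares: the trace has length 2 and the second residue is the double point
`2P` at `P = [0:0:1]`. -/
theorem stmt_11 :
    (Ideal.span {x ^ 2 - x * y, x * y ^ 2, y ^ 3} ⊔ Ideal.span {y} =
        Ideal.span {x ^ 2, y}) ∧
    (Ideal.span {x ^ 2 - x * y, x * y ^ 2, y ^ 3}).colon (Ideal.span {y}) =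
      (Ideal.span {x, y}) ^ 2 := by
  refine ⟨Ideal.span_triple_sup_span_singleton _ _,
    Ideal.span_triple_colon_span_singleton X_prime ?_⟩
  rw [X_dvd_X]
  decide
end

section
/- Let α ∈ ℂ with α ≠ 0 and α ≠ −1. In ℂ[x,y,z], the ideal I = (x² − xy, xy², y³) satisfies: (i) I + (x + αy) = (y², x + αy), and (ii) I : (x + αy) = (x, y)². -/
open MvPolynomial

local notation "x" => (X 0 : MvPolynomial (Fin 3) ℂ)
local notation "y" => (X 1 : MvPolynomial (Fin 3) ℂ)
local notation "z" => (X 2 : MvPolynomial (Fin 3) ℂ)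

/-- If `f * (x + αy)` lies in `(x² − xy, xy², y³)`, then `f` lies in `(x, y)²`. -/
lemma mem_sq_span_of_mul_line_eq {α : ℂ} (hα0 : α ≠ 0) (hα1 : α ≠ -1)
    {f a b c : MvPolynomial (Fin 3) ℂ}
    (h : f * (x + C α * y) = a * (x ^ 2 - x * y) + b * (x * y ^ 2) + c * y ^ 3) :
    f ∈ (Ideal.span {x, y}) ^ 2 := by
  have hx0 : x ≠ 0 := X_ne_zero 0
  have hy0 : y ≠ 0 := X_ne_zero 1
  have hx : Prime x := X_prime
  have hy : Prime y := X_prime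
  have hxy : ¬ x ∣ y := by simp [X_dvd_X]
  have hyx : ¬ y ∣ x := by simp [X_dvd_X]
  have hC : C α⁻¹ * C α = (1 : MvPolynomial (Fin 3) ℂ) := by
    rw [← C_mul, inv_mul_cancel₀ hα0, C_1]
  have hC' : C (1 + α)⁻¹ * (1 + C α) = (1 : MvPolynomial (Fin 3) ℂ) := by
    have h1 : 1 + α ≠ 0 := fun h0 => hα1 (by linear_combination h0)
    rw [← C_1, ← C_add, ← C_mul, inv_mul_cancel₀ h1]
  have hxm : x ∈ Ideal.span {x, y} := Ideal.subset_span (by simp)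
  have hym : y ∈ Ideal.span {x, y} := Ideal.subset_span (by simp)
  obtain ⟨g, hg⟩ : y ∣ f - x * a :=
    (hy.dvd_or_dvd ⟨-a * x + b * x * y + c * y ^ 2 - f * C α,
      by linear_combination h⟩ : y ∣ x ∨ y ∣ f - x * a).resolve_left hyx
  have h2 : (1 + C α) * x * a + g * (x + C α * y) = b * x * y + c * y ^ 2 := by
    refine mul_left_cancel₀ hy0 ?_
    linear_combination h - (x + C α * y) * hg
  obtain ⟨k, hk⟩ : x ∣ C α * g - c * y :=
    (hx.dvd_or_dvd ⟨b * y - (1 + C α) * a - g,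
      by linear_combination h2⟩ : x ∣ y ∨ x ∣ C α * g - c * y).resolve_left hxy
  have h3 : (1 + C α) * a = b * y - g - k * y := by
    refine mul_left_cancel₀ hx0 ?_
    linear_combination h2 - y * hk
  have hgm : g ∈ Ideal.span {x, y} := by
    have : g = (C α⁻¹ * k) * x + (C α⁻¹ * c) * y := by
      linear_combination C α⁻¹ * hk - g * hC
    rw [this]
    exact add_mem (Ideal.mul_mem_left _ _ hxm) (Ideal.mul_mem_left _ _ hym)
  have ham : a ∈ Ideal.span {x, y} := by
    have : a = C (1 + α)⁻¹ * ((b - k) * y - g) := by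
      linear_combination C (1 + α)⁻¹ * h3 - a * hC'
    rw [this]
    exact Ideal.mul_mem_left _ _ (sub_mem (Ideal.mul_mem_left _ _ hym) hgm)
  have hf : f = x * a + y * g := by linear_combination hg
  rw [hf, pow_two]
  exact add_mem (Ideal.mul_mem_mul hxm ham) (Ideal.mul_mem_mul hym hgm)

/-- Trace and residue of `I = (x² − xy, xy², y³)` with respect to a generic
line `m : x + αy = 0` through `P = [0:0:1]` (generic meaning `α ∉ {0, −1}`):
the trace has length 2 and the residue is the double point `2P`. -/
theorem stmt_12 (α : ℂ) (hα0 : α ≠ 0) (hα1 : α ≠ -1) :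
    (Ideal.span {x ^ 2 - x * y, x * y ^ 2, y ^ 3} ⊔
        Ideal.span {x + C α * y} = Ideal.span {y ^ 2, x + C α * y}) ∧
    (Ideal.span {x ^ 2 - x * y, x * y ^ 2, y ^ 3}).colon
        (Ideal.span {x + C α * y}) = (Ideal.span {x, y}) ^ 2 := by
  have hC : C (α ^ 2 + α)⁻¹ * (C α ^ 2 + C α) = (1 : MvPolynomial (Fin 3) ℂ) := by
    have h1 : α ^ 2 + α ≠ 0 := by
      have h2 : α + 1 ≠ 0 := fun h0 => hα1 (by linear_combination h0)
      have h3 := mul_ne_zero hα0 h2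
      rwa [mul_add, mul_one, ← pow_two] at h3
    rw [← C_pow, ← C_add, ← C_mul, inv_mul_cancel₀ h1, C_1]
  refine ⟨?_, le_antisymm ?_ ?_⟩
  · rw [← Ideal.span_union]
    apply le_antisymm <;> rw [Ideal.span_le]
    · rintro p (hp | hp)
      · rw [SetLike.mem_coe, Ideal.mem_span_pair]
        rcases hp with rfl | rfl | rfl
        · exact ⟨C α ^ 2 + C α, x - (C α + 1) * y, by ring⟩
        · exact ⟨x, 0, by ring⟩
        · exact ⟨y, 0, by ring⟩
      · exact Ideal.subset_span (Or.inr hp)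
    · have hq : x ^ 2 - x * y ∈ Ideal.span
          ({x ^ 2 - x * y, x * y ^ 2, y ^ 3} ∪ {x + C α * y}) :=
        Ideal.subset_span (by simp)
      have hl : x + C α * y ∈ Ideal.span
          ({x ^ 2 - x * y, x * y ^ 2, y ^ 3} ∪ {x + C α * y}) :=
        Ideal.subset_span (by simp)
      rintro p (rfl | rfl)
      · have : y ^ 2 = C (α ^ 2 + α)⁻¹ * (x ^ 2 - x * y) +
            (-C (α ^ 2 + α)⁻¹ * (x - (C α + 1) * y)) * (x + C α * y) := by
          linear_combination -y ^ 2 * hC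
        refine (congrArg (· ∈ Ideal.span _) this).mpr ?_
        exact add_mem (Ideal.mul_mem_left _ _ hq) (Ideal.mul_mem_left _ _ hl)
      · exact hl
  · intro f hf
    have h := Submodule.mem_colon.mp hf _ (Ideal.mem_span_singleton_self (x + C α * y))
    rw [smul_eq_mul, Ideal.mem_span_insert] at h
    obtain ⟨a, w, hw, h⟩ := h
    obtain ⟨b, c, rfl⟩ := Ideal.mem_span_pair.mp hw
    exact mem_sq_span_of_mul_line_eq hα0 hα1 (by rw [h, add_assoc])
  · rw [pow_two, Ideal.span_pair_mul_span_pair, Ideal.span_le]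
    intro p hp
    refine Submodule.mem_colon.mpr fun q hq => ?_
    obtain ⟨r, rfl⟩ := Ideal.mem_span_singleton'.mp hq
    rw [smul_eq_mul, mul_left_comm]
    refine Ideal.mul_mem_left _ _ ?_
    rw [Ideal.mem_span_insert]
    simp only [Ideal.mem_span_pair]
    rcases hp with rfl | rfl | rfl | rfl
    · exact ⟨x + (1 + C α) * y, _, ⟨1 + C α, 0, rfl⟩, by ring⟩
    · exact ⟨y, _, ⟨1 + C α, 0, rfl⟩, by ring⟩
    · exact ⟨y, _, ⟨1 + C α, 0, rfl⟩, by ring⟩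
    · exact ⟨0, _, ⟨1, C α, rfl⟩, by ring⟩
end

section
/- dim_ℂ ℂ[x,y] / (x²y − xy², x³ − y³, y⁴) = 8. That is, the flat limit of two 2-squares colliding at a point is a local 0-dimensional scheme of length 8. -/
open MvPolynomial

local notation "x" => (X 0 : MvPolynomial (Fin 2) ℂ)
local notation "y" => (X 1 : MvPolynomial (Fin 2) ℂ)

namespace CollidingSquares

/-- The ideal of the limit scheme. -/
noncomputable abbrev limitIdeal : Ideal (MvPolynomial (Fin 2) ℂ) :=
  Ideal.span {x ^ 2 * y - x * y ^ 2, x ^ 3 - y ^ 3, y ^ 4}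

/-- Monomials representing a basis of the quotient by `limitIdeal`. -/
noncomputable def basisMonomial : Fin 8 → MvPolynomial (Fin 2) ℂ :=
  ![1, x, y, x ^ 2, x * y, y ^ 2, x ^ 2 * y, x ^ 3]

/-- The partial derivative with respect to the `i`-th variable, as a linear map. -/
noncomputable abbrev partialDeriv (i : Fin 2) :
    MvPolynomial (Fin 2) ℂ →ₗ[ℂ] MvPolynomial (Fin 2) ℂ :=
  (pderiv i : Derivation ℂ (MvPolynomial (Fin 2) ℂ) (MvPolynomial (Fin 2) ℂ)).toLinearMap

/-- Differential operators, evaluated at the origin, which are dual to `basisMonomial` up to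
nonzero scalars and span the Macaulay inverse system of `limitIdeal`. -/
noncomputable def inverseSystem : MvPolynomial (Fin 2) ℂ →ₗ[ℂ] (Fin 8 → ℂ) :=
  LinearMap.pi fun j => (aeval (0 : Fin 2 → ℂ)).toLinearMap ∘ₗ
    (![LinearMap.id, partialDeriv 0, partialDeriv 1, partialDeriv 0 ∘ₗ partialDeriv 0,
      partialDeriv 0 ∘ₗ partialDeriv 1, partialDeriv 1 ∘ₗ partialDeriv 1,
      partialDeriv 0 ∘ₗ partialDeriv 0 ∘ₗ partialDeriv 1 +
        partialDeriv 0 ∘ₗ partialDeriv 1 ∘ₗ partialDeriv 1,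
      partialDeriv 0 ∘ₗ partialDeriv 0 ∘ₗ partialDeriv 0 +
        partialDeriv 1 ∘ₗ partialDeriv 1 ∘ₗ partialDeriv 1] :
      Fin 8 → MvPolynomial (Fin 2) ℂ →ₗ[ℂ] MvPolynomial (Fin 2) ℂ) j

theorem inverseSystem_mul_eq_zero (p : MvPolynomial (Fin 2) ℂ) {g : MvPolynomial (Fin 2) ℂ}
    (hg : g ∈ ({x ^ 2 * y - x * y ^ 2, x ^ 3 - y ^ 3, y ^ 4} : Set _)) :
    inverseSystem (p * g) = 0 := by
  rcases hg with rfl | rfl | rfl <;> ext j <;> fin_cases j <;>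
    simp [inverseSystem, Derivation.leibniz, Derivation.leibniz_pow, pderiv_X]

theorem inverseSystem_eq_zero {p : MvPolynomial (Fin 2) ℂ} (hp : p ∈ limitIdeal) :
    inverseSystem p = 0 := by
  induction hp using Submodule.closure_induction with
  | zero => exact map_zero _
  | add p q _ _ hp hq => rw [map_add, hp, hq, add_zero]
  | smul_mem r g hg => exact inverseSystem_mul_eq_zero r hg

theorem linearIndependent_inverseSystem :
    LinearIndependent ℂ fun j => inverseSystem (basisMonomial j) := by
  rw [Fintype.linearIndependent_iff]
  intro c hc i
  have h := congrFun hc i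
  have h₂ : (2 : MvPolynomial (Fin 2) ℂ) = C 2 := (map_ofNat C 2).symm
  have h₃ : (3 : MvPolynomial (Fin 2) ℂ) = C 3 := (map_ofNat C 3).symm
  revert h
  fin_cases i <;>
    simp [Fin.sum_univ_eight, inverseSystem, basisMonomial, Derivation.leibniz,
      Derivation.leibniz_pow, pderiv_X, h₂, h₃]

theorem linearIndependent_mk :
    LinearIndependent ℂ fun j => Ideal.Quotient.mk limitIdeal (basisMonomial j) := by
  let f : (MvPolynomial (Fin 2) ℂ ⧸ limitIdeal) →ₗ[ℂ] (Fin 8 → ℂ) :=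
    Submodule.liftQ (limitIdeal.restrictScalars ℂ) inverseSystem
      fun p hp => inverseSystem_eq_zero hp
  exact LinearIndependent.of_comp f linearIndependent_inverseSystem

theorem mk_mul_X_mem_span (i : Fin 2) (j : Fin 8) :
    Ideal.Quotient.mk limitIdeal (basisMonomial j * X i) ∈
      Submodule.span ℂ (Set.range fun j => Ideal.Quotient.mk limitIdeal (basisMonomial j)) := by
  have h₁ : x ^ 2 * y - x * y ^ 2 ∈ limitIdeal := Ideal.subset_span (by simp)
  have h₂ : x ^ 3 - y ^ 3 ∈ limitIdeal := Ideal.subset_span (by simp)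
  have h₃ : y ^ 4 ∈ limitIdeal := Ideal.subset_span (by simp)
  have of_mem {p : MvPolynomial (Fin 2) ℂ} (hp : p ∈ limitIdeal) :
      Ideal.Quotient.mk limitIdeal p ∈
        Submodule.span ℂ (Set.range fun j => Ideal.Quotient.mk limitIdeal (basisMonomial j)) := by
    rw [Ideal.Quotient.eq_zero_iff_mem.mpr hp]
    exact zero_mem _
  have of_sub_mem {p : MvPolynomial (Fin 2) ℂ} (k : Fin 8)
      (hp : basisMonomial k - p ∈ limitIdeal) :
      Ideal.Quotient.mk limitIdeal p ∈
        Submodule.span ℂ (Set.range fun j => Ideal.Quotient.mk limitIdeal (basisMonomial j)) := by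
    rw [← Ideal.Quotient.eq.mpr hp]
    exact Submodule.subset_span ⟨k, rfl⟩
  have of_eq {p : MvPolynomial (Fin 2) ℂ} (k : Fin 8) (hp : basisMonomial k = p) :=
    of_sub_mem k (hp ▸ by simp : basisMonomial k - p ∈ limitIdeal)
  have hx₃y : x ^ 3 * y ∈ limitIdeal := by
    convert add_mem (limitIdeal.mul_mem_left y h₂) h₃ using 1
    ring
  have hx₂y₂ : x ^ 2 * y ^ 2 ∈ limitIdeal := by
    convert sub_mem hx₃y (limitIdeal.mul_mem_left x h₁) using 1
    ring
  have hx₄ : x ^ 4 ∈ limitIdeal := by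
    convert add_mem (limitIdeal.mul_mem_left x h₂)
      (sub_mem hx₂y₂ (limitIdeal.mul_mem_left y h₁)) using 1
    ring
  fin_cases i <;> fin_cases j <;> simp only [basisMonomial]
  · exact of_eq 1 (by simp [basisMonomial])
  · exact of_eq 3 (by simp [basisMonomial]; ring)
  · exact of_eq 4 (by simp [basisMonomial]; ring)
  · exact of_eq 7 (by simp [basisMonomial]; ring)
  · exact of_eq 6 (by simp [basisMonomial]; ring)
  · exact of_sub_mem 6 (by convert h₁ using 1; simp [basisMonomial]; ring)
  · exact of_mem (by convert hx₃y using 1; simp; ring)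
  · exact of_mem (by convert hx₄ using 1; simp; ring)
  · exact of_eq 2 (by simp [basisMonomial])
  · exact of_eq 4 (by simp [basisMonomial])
  · exact of_eq 5 (by simp [basisMonomial]; ring)
  · exact of_eq 6 (by simp [basisMonomial])
  · exact of_sub_mem 6 (by convert h₁ using 1; simp [basisMonomial]; ring)
  · exact of_sub_mem 7 (by convert h₂ using 1; simp [basisMonomial]; ring)
  · exact of_mem (by convert hx₂y₂ using 1; simp; ring)
  · exact of_mem (by convert hx₃y using 1; simp)

theorem span_mk_eq_top :
    Submodule.span ℂ (Set.range fun j => Ideal.Quotient.mk limitIdeal (basisMonomial j)) = ⊤ := by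
  rw [eq_top_iff]
  rintro q -
  obtain ⟨p, rfl⟩ := Ideal.Quotient.mk_surjective q
  induction p using MvPolynomial.induction_on with
  | C a =>
    have h : Ideal.Quotient.mk limitIdeal (C a) =
        a • Ideal.Quotient.mk limitIdeal (basisMonomial 0) :=
      congrArg (Ideal.Quotient.mk limitIdeal)
        (by simp [basisMonomial, smul_eq_C_mul] : C a = a • basisMonomial 0)
    rw [h]
    exact Submodule.smul_mem _ a (Submodule.subset_span (Set.mem_range_self 0))
  | add p q hp hq =>
    rw [map_add]
    exact add_mem hp hq
  | mul_X p i hp =>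
    rw [map_mul]
    refine Submodule.span_induction (p := fun q _ => q * Ideal.Quotient.mk limitIdeal (X i) ∈
      Submodule.span ℂ (Set.range fun j => Ideal.Quotient.mk limitIdeal (basisMonomial j)))
      ?_ ?_ ?_ ?_ hp
    · rintro _ ⟨j, rfl⟩
      simpa only [map_mul] using mk_mul_X_mem_span i j
    · rw [zero_mul]
      exact zero_mem _
    · intro a b _ _ ha hb
      rw [add_mul]
      exact add_mem ha hb
    · intro c a _ ha
      rw [smul_mul_assoc]
      exact Submodule.smul_mem _ c ha

end CollidingSquares

/-- The flat limit of two 2-squares colliding at a point is a local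
0-dimensional scheme of length 8. -/
theorem stmt_13 :
    Module.finrank ℂ
      (MvPolynomial (Fin 2) ℂ ⧸
        Ideal.span {x ^ 2 * y - x * y ^ 2, x ^ 3 - y ^ 3, y ^ 4}) = 8 := by
  simpa using Module.finrank_eq_card_basis
    (Module.Basis.mk CollidingSquares.linearIndependent_mk CollidingSquares.span_mk_eq_top.ge)
end

section
/- In ℂ[x,y,z] one has the ideal equalities: (i) ((x−y)², (x+y)²) = (x² + y², xy, y³), and (ii) ((x−y)², (x+y)²) : (y) = (x, y²). In particular the residue with respect to the line r : y = 0 of the 2-square with ideal ((x−y)², (x+y)²) is a length-2 jet not contained in r, and its trace on r has length 1. -/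
open MvPolynomial

local notation "x" => (X 0 : MvPolynomial (Fin 3) ℂ)
local notation "y" => (X 1 : MvPolynomial (Fin 3) ℂ)
local notation "z" => (X 2 : MvPolynomial (Fin 3) ℂ)

theorem span_sq_sub_sq_add_eq :
    Ideal.span {(x - y) ^ 2, (x + y) ^ 2} =
      Ideal.span {x ^ 2 + y ^ 2, x * y, y ^ 3} := by
  have h2 : (C (1 / 2) : MvPolynomial (Fin 3) ℂ) * 2 = 1 := by
    rw [← map_ofNat C 2, ← C_mul]; norm_num
  apply le_antisymm <;> rw [Ideal.span_le]
  · rintro p (rfl | rfl)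
    · exact Ideal.mem_span_insert.2 ⟨1, -2 * (x * y),
        Ideal.mem_span_pair.2 ⟨-2, 0, by ring⟩, by ring⟩
    · exact Ideal.mem_span_insert.2 ⟨1, 2 * (x * y),
        Ideal.mem_span_pair.2 ⟨2, 0, by ring⟩, by ring⟩
  · rintro p (rfl | rfl | rfl)
    · exact Ideal.mem_span_pair.2 ⟨C (1 / 2), C (1 / 2), by
        linear_combination (x ^ 2 + y ^ 2) * h2⟩
    · exact Ideal.mem_span_pair.2 ⟨-C (1 / 2) ^ 2, C (1 / 2) ^ 2, by
        linear_combination (x * y) * (C (1 / 2) * 2 + 1) * h2⟩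
    · exact Ideal.mem_span_pair.2
        ⟨y * C (1 / 2) + x * C (1 / 2) ^ 2, y * C (1 / 2) - x * C (1 / 2) ^ 2, by
        linear_combination (y * (x ^ 2 + y ^ 2)) * h2
          - (x ^ 2 * y) * (C (1 / 2) * 2 + 1) * h2⟩

theorem span_sq_add_sq_colon_eq :
    (Ideal.span {x ^ 2 + y ^ 2, x * y, y ^ 3}).colon (Ideal.span {y}) =
      Ideal.span {x, y ^ 2} := by
  ext f
  rw [Submodule.mem_colon]
  constructor
  · intro h
    have hf := h y (Ideal.mem_span_singleton_self y)
    rw [smul_eq_mul, Ideal.mem_span_insert] at hf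
    obtain ⟨a, w, hw, hf⟩ := hf
    obtain ⟨b, c, rfl⟩ := Ideal.mem_span_pair.1 hw
    have hy : Prime y := X_prime
    have hdvd : y ∣ a * x ^ 2 :=
      ⟨f - a * y - b * x - c * y ^ 2, by linear_combination -hf⟩
    have ha : y ∣ a := by
      refine (hy.dvd_or_dvd hdvd).resolve_right fun h' => ?_
      have := hy.dvd_of_dvd_pow h'
      simp [X_dvd_X] at this
    obtain ⟨a', rfl⟩ := ha
    refine Ideal.mem_span_pair.2 ⟨a' * x + b, a' + c, ?_⟩
    apply mul_right_cancel₀ hy.ne_zero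
    linear_combination -hf
  · intro hf p hp
    obtain ⟨a, b, rfl⟩ := Ideal.mem_span_pair.1 hf
    obtain ⟨q, rfl⟩ := Ideal.mem_span_singleton'.1 hp
    exact Ideal.mem_span_insert.2 ⟨0, _,
      Ideal.mem_span_pair.2 ⟨a * q, b * q, rfl⟩, by rw [smul_eq_mul]; ring⟩

theorem X_one_notMem_span :
    y ∉ Ideal.span ({x, y ^ 2} : Set (MvPolynomial (Fin 3) ℂ)) := by
  intro h
  obtain ⟨a, b, h⟩ := Ideal.mem_span_pair.1 h
  have h' := congrArg (fun p => eval 0 (pderiv 1 p)) h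
  simp [pderiv_X, Derivation.leibniz, Derivation.leibniz_pow] at h'

theorem span_sup_span_X_one_eq :
    Ideal.span {x, y ^ 2} ⊔ Ideal.span {y} =
      Ideal.span ({x, y} : Set (MvPolynomial (Fin 3) ℂ)) := by
  rw [← Ideal.span_union]
  apply le_antisymm <;> rw [Ideal.span_le]
  · rintro p ((rfl | rfl) | rfl)
    · exact Ideal.subset_span (by simp)
    · exact Ideal.mem_span_pair.2 ⟨0, y, by ring⟩
    · exact Ideal.subset_span (by simp)
  · rintro p (rfl | rfl) <;> exact Ideal.subset_span (by simp)

/-- The 2-square `((x−y)², (x+y)²)` specialised as type (1.b) with respect to the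
line `r : y = 0`: its ideal equals `(x² + y², xy, y³)`, its residue with respect
to `r` is the length-2 jet `(x, y²)` not contained in `r`, and the trace of this
jet on `r` has length 1. -/
theorem stmt_14 :
    (Ideal.span {(x - y) ^ 2, (x + y) ^ 2} =
        Ideal.span {x ^ 2 + y ^ 2, x * y, y ^ 3}) ∧
    ((Ideal.span {(x - y) ^ 2, (x + y) ^ 2}).colon (Ideal.span {y}) =
        Ideal.span {x, y ^ 2}) ∧
    y ∉ Ideal.span ({x, y ^ 2} : Set (MvPolynomial (Fin 3) ℂ)) ∧
    (Ideal.span {x, y ^ 2} ⊔ Ideal.span {y} =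
      Ideal.span ({x, y} : Set (MvPolynomial (Fin 3) ℂ))) := by
  refine ⟨span_sq_sub_sq_add_eq, ?_, X_one_notMem_span, span_sup_span_X_one_eq⟩
  rw [span_sq_sub_sq_add_eq]
  exact span_sq_add_sq_colon_eq
end
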